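/- arXiv:2109.06833 — 6 statements merged into one kernel-verified Lean document; each statement's English description precedes it below -/
import Mathlib

section
/- Let r₁,…,rₙ be distinct positive real numbers. Then (1/|V|) ∫₀^∞ |Σ_{k=1}^n (−1)^k V_k e^{−r_k x}| dx = 1/(r₁r₂⋯rₙ), where V = V(r₁,…,rₙ) and V_k = V(r₁,…,r_{k−1},r_{k+1},…,rₙ) are Vandermonde determinants. -/
open MeasureTheory

/-- Vandermonde determinant of the real numbers `r₁, …, rₙ` with the `k`-th entry deleted. -/
noncomputable def VandDelR {n : ℕ} (r : Fin (n + 1) → ℝ) (k : Fin (n + 1)) : ℝ :=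
  (Matrix.vandermonde fun i : Fin n => r (k.succAbove i)).det

open Lagrange in
theorem sum_nodalWeight_eq_zero {F ι : Type*} [Field F] [DecidableEq ι] {s : Finset ι} {v : ι → F}
    (hvs : Set.InjOn v s) (hs : 1 < s.card) : ∑ i ∈ s, nodalWeight s v i = 0 := by
  have h := coeff_eq_sum hvs (P := (1 : Polynomial F)) (by
    rw [Polynomial.degree_one]; exact_mod_cast (by omega : 0 < s.card))
  rw [Polynomial.coeff_one, if_neg (by omega)] at h
  simpa [nodalWeight] using h.symm

open Lagrange in
theorem nodalWeight_cons_mul_sub {F ι : Type*} [Field F] [DecidableEq ι] {s : Finset ι} {v : ι → F}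
    {a i : ι} (ha : a ∉ s) (hi : i ∈ s) (hv : v i ≠ v a) :
    nodalWeight (s.cons a ha) v i * (v i - v a) = nodalWeight s v i := by
  have hne : i ≠ a := fun h => ha (h ▸ hi)
  have hsub : v i - v a ≠ 0 := sub_ne_zero.2 hv
  rw [nodalWeight, nodalWeight, Finset.cons_eq_insert, Finset.erase_insert_of_ne hne.symm,
    Finset.prod_insert fun h => ha (Finset.mem_of_mem_erase h)]
  field_simp

open Lagrange in
/-- The divided differences of `t ↦ exp (t * x)` are nonnegative for `0 ≤ x`. -/
theorem sum_nodalWeight_mul_exp_nonneg {ι : Type*} [DecidableEq ι] {s : Finset ι} (hs : s.Nonempty)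
    {v : ι → ℝ} (hv : Function.Injective v) {x : ℝ} (hx : 0 ≤ x) :
    0 ≤ ∑ i ∈ s, nodalWeight s v i * Real.exp (v i * x) := by
  induction hs using Finset.Nonempty.cons_induction generalizing x with
  | singleton a => simpa [nodalWeight] using (Real.exp_pos _).le
  | cons a s ha hs ih =>
    set w := nodalWeight (s.cons a ha) v with hw
    have hderiv (y : ℝ) : HasDerivAt
        (fun y => ∑ i ∈ s.cons a ha, w i * Real.exp ((v i - v a) * y))
        ((∑ i ∈ s, nodalWeight s v i * Real.exp (v i * y)) * Real.exp (-(v a * y))) y := by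
      have h : HasDerivAt (fun y => ∑ i ∈ s.cons a ha, w i * Real.exp ((v i - v a) * y))
          (∑ i ∈ s.cons a ha, w i * (Real.exp ((v i - v a) * y) * ((v i - v a) * 1))) y :=
        HasDerivAt.fun_sum fun i _ =>
          (((hasDerivAt_id y).const_mul (v i - v a)).exp).const_mul (w i)
      convert h using 1
      rw [Finset.sum_cons, sub_self, zero_mul, zero_mul, mul_zero, mul_zero, zero_add, Finset.sum_mul]
      refine Finset.sum_congr rfl fun i hi => ?_
      rw [← nodalWeight_cons_mul_sub ha hi (hv.ne fun h => ha (h ▸ hi)), ← hw, mul_assoc,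
        mul_assoc, ← Real.exp_add]
      ring_nf
    have hmono : MonotoneOn (fun y => ∑ i ∈ s.cons a ha, w i * Real.exp ((v i - v a) * y))
        (Set.Ici 0) := by
      refine monotoneOn_of_deriv_nonneg (convex_Ici 0)
        (fun y _ => (hderiv y).continuousAt.continuousWithinAt)
        (fun y _ => (hderiv y).differentiableAt.differentiableWithinAt) fun y hy => ?_
      rw [(hderiv y).deriv]
      exact mul_nonneg (ih (interior_subset hy)) (Real.exp_pos _).le
    have h0 := hmono Set.self_mem_Ici hx hx
    have hcard : 1 < (s.cons a ha).card := by
      rw [Finset.card_cons]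
      have := hs.card_pos
      omega
    simp only [mul_zero, Real.exp_zero, mul_one] at h0
    rw [hw, sum_nodalWeight_eq_zero hv.injOn hcard, ← hw] at h0
    calc 0 ≤ (∑ i ∈ s.cons a ha, w i * Real.exp ((v i - v a) * x)) * Real.exp (v a * x) :=
          mul_nonneg h0 (Real.exp_pos _).le
      _ = _ := by
          rw [Finset.sum_mul]
          refine Finset.sum_congr rfl fun i _ => ?_
          rw [mul_assoc, ← Real.exp_add]
          ring_nf

open Lagrange in
theorem nodal_eval_mul_sum_nodalWeight_mul_inv_sub {F ι : Type*} [Field F] [DecidableEq ι]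
    {s : Finset ι} {v : ι → F} {x : F} (hvs : Set.InjOn v s) (hx : ∀ i ∈ s, x ≠ v i)
    (hs : s.Nonempty) :
    (nodal s v).eval x * ∑ i ∈ s, nodalWeight s v i * (x - v i)⁻¹ = 1 := by
  simpa only [Pi.one_apply, interpolate_one hvs hs, Polynomial.eval_one, mul_one] using
    (eval_interpolate_not_at_node (F := F) 1 hx).symm

/-- Factoring out of a Vandermonde determinant all the differences that involve the `k`-th entry. -/
theorem det_vandermonde_eq_mul_prod_succAbove {R : Type*} [CommRing R] {n : ℕ}
    (r : Fin (n + 1) → R) (k : Fin (n + 1)) :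
    (Matrix.vandermonde r).det = (-1) ^ (k : ℕ) *
      ((∏ i, (r (k.succAbove i) - r k)) *
        (Matrix.vandermonde fun i => r (k.succAbove i)).det) := by
  have hperm := Matrix.det_permute k.cycleRange.symm (Matrix.vandermonde r)
  have hsub : (Matrix.vandermonde r).submatrix k.cycleRange.symm id =
      Matrix.vandermonde (r ∘ k.cycleRange.symm) := rfl
  have hfac : (Matrix.vandermonde (r ∘ k.cycleRange.symm)).det =
      (∏ i, (r (k.succAbove i) - r k)) *
        (Matrix.vandermonde fun i => r (k.succAbove i)).det := by
    rw [Matrix.det_vandermonde, Matrix.det_vandermonde, Fin.prod_univ_succ]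
    simp only [Fin.prod_Ioi_zero, Fin.prod_Ioi_succ, Function.comp_apply,
      Fin.cycleRange_symm_zero, Fin.cycleRange_symm_succ]
  rw [← hfac, ← hsub, hperm, Equiv.Perm.sign_symm, Fin.sign_cycleRange]
  push_cast
  rw [← mul_assoc, ← mul_pow, neg_one_mul, neg_neg, one_pow, one_mul]

theorem neg_one_pow_mul_VandDelR {n : ℕ} {r : Fin (n + 1) → ℝ} (hinj : Function.Injective r)
    (k : Fin (n + 1)) :
    (-1 : ℝ) ^ (k : ℕ) * VandDelR r k =
      (Matrix.vandermonde r).det * Lagrange.nodalWeight Finset.univ (fun i => -r i) k := by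
  have hw : Lagrange.nodalWeight Finset.univ (fun i => -r i) k =
      (∏ i, (r (k.succAbove i) - r k))⁻¹ := by
    rw [Lagrange.nodalWeight, Finset.prod_inv_distrib, ← Finset.compl_singleton,
      ← Fin.image_succAbove_univ, Finset.prod_image fun _ _ _ _ h => Fin.succAbove_right_injective h]
    congr 1
    exact Finset.prod_congr rfl fun i _ => by ring
  have hne : ∏ i, (r (k.succAbove i) - r k) ≠ 0 :=
    Finset.prod_ne_zero_iff.2 fun i _ => sub_ne_zero.2 (hinj.ne (k.succAbove_ne i))
  rw [hw, det_vandermonde_eq_mul_prod_succAbove r k, VandDelR]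
  field_simp

theorem stmt9 (n : ℕ) (r : Fin (n + 1) → ℝ)
    (hinj : Function.Injective r) (hpos : ∀ k, 0 < r k) :
    (1 / |(Matrix.vandermonde r).det|) *
      ∫ x in Set.Ioi (0 : ℝ),
        |∑ k : Fin (n + 1), (-1 : ℝ) ^ ((k : ℕ) + 1) * VandDelR r k * Real.exp (-(r k) * x)| =
    1 / ∏ k : Fin (n + 1), r k := by
  set V := (Matrix.vandermonde r).det with hV
  set w := Lagrange.nodalWeight Finset.univ (fun i => -r i) with hw
  have hinj' : Function.Injective fun i => -r i := neg_injective.comp hinj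
  have hV0 : |V| ≠ 0 := abs_ne_zero.2 (Matrix.det_vandermonde_ne_zero_iff.2 hinj)
  have habs : ∀ x ∈ Set.Ioi (0 : ℝ),
      |∑ k : Fin (n + 1), (-1 : ℝ) ^ ((k : ℕ) + 1) * VandDelR r k * Real.exp (-(r k) * x)| =
        |V| * ∑ k, w k * Real.exp (-(r k) * x) := by
    intro x hx
    have hsum : ∑ k : Fin (n + 1), (-1 : ℝ) ^ ((k : ℕ) + 1) * VandDelR r k *
        Real.exp (-(r k) * x) = -V * ∑ k, w k * Real.exp (-(r k) * x) := by
      rw [Finset.mul_sum]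
      refine Finset.sum_congr rfl fun k _ => ?_
      rw [pow_succ, mul_neg_one, neg_mul, neg_one_pow_mul_VandDelR hinj]
      ring
    rw [hsum, abs_mul, abs_neg, abs_of_nonneg
      (sum_nodalWeight_mul_exp_nonneg Finset.univ_nonempty hinj' (le_of_lt hx))]
  have hnodal := nodal_eval_mul_sum_nodalWeight_mul_inv_sub (s := Finset.univ) (x := 0)
    hinj'.injOn (fun i _ => (neg_neg_of_pos (hpos i)).ne') Finset.univ_nonempty
  simp only [Lagrange.eval_nodal, zero_sub, neg_neg, ← hw] at hnodal
  rw [setIntegral_congr_fun measurableSet_Ioi habs, integral_const_mul, ← mul_assoc,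
    one_div_mul_cancel hV0, one_mul, integral_finsetSum _ fun k _ =>
      (integrableOn_exp_mul_Ioi (neg_neg_of_pos (hpos k)) 0).const_mul (w k)]
  rw [← eq_one_div_of_mul_eq_one_right hnodal]
  refine Finset.sum_congr rfl fun k _ => ?_
  rw [integral_const_mul, integral_exp_mul_Ioi (neg_neg_of_pos (hpos k))]
  simp [neg_div_neg_eq]
end

section
/- Suppose the characteristic equation P(z)=0 of D has distinct roots r_k = ρ_k + iα for 1 ≤ k ≤ n, where α ∈ ℝ is the same for all k and ρ_k ∈ ℝ∖{0} (so no root lies on the imaginary axis). Then the best Ulam constant of D equals 1/(|ρ₁|·|ρ₂|⋯|ρₙ|) = 1/∏_{k=1}^n |Re r_k|. -/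
open MeasureTheory

/-- The linear differential operator `D(y) = y⁽ⁿ⁾ + a₁ y⁽ⁿ⁻¹⁾ + ⋯ + aₙ y`,
where `a j` is the coefficient of `y⁽ⁿ⁻¹⁻ʲ⁾` (zero-based indexing). -/
noncomputable def Dop {X : Type*} [NormedAddCommGroup X] [NormedSpace ℂ X]
    (n : ℕ) (a : Fin n → ℂ) (y : ℝ → X) : ℝ → X :=
  fun t => iteratedDeriv n y t + ∑ j : Fin n, a j • iteratedDeriv (n - 1 - (j : ℕ)) y t

/-- `K` is an Ulam constant of the operator `D` determined by the coefficients `a`. -/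
def IsUlamConstant {X : Type*} [NormedAddCommGroup X] [NormedSpace ℂ X]
    (n : ℕ) (a : Fin n → ℂ) (K : ℝ) : Prop :=
  0 ≤ K ∧ ∀ ε : ℝ, 0 < ε → ∀ y : ℝ → X, ContDiff ℝ n y →
    (∀ t : ℝ, ‖Dop n a y t‖ ≤ ε) →
    ∃ z : ℝ → X, ContDiff ℝ n z ∧ Dop n a z = 0 ∧ ∀ t : ℝ, ‖y t - z t‖ ≤ K * ε

theorem eq_zero_of_norm_mul_pow_le {E : Type*} [NormedAddCommGroup E] {x : E} {q M : ℝ}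
    (hq : 1 < q) (h : ∀ m : ℕ, ‖x‖ * q ^ m ≤ M) : x = 0 := by
  by_contra hx
  have hx' : 0 < ‖x‖ := norm_pos_iff.2 hx
  obtain ⟨m, hm⟩ := pow_unbounded_of_one_lt (M / ‖x‖) hq
  rw [div_lt_iff₀ hx', mul_comm] at hm
  exact absurd (h m) hm.not_ge

section LinearODE

variable {E : Type*} [NormedAddCommGroup E] [NormedSpace ℂ E]

/-- The constant coefficient differential operator `p(d/dt)` applied to `y`, as a linear map in
the polynomial `p`. -/
noncomputable def polyDiff (y : ℝ → E) : Polynomial ℂ →ₗ[ℂ] (ℝ → E) :=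
  Polynomial.lsum fun i => LinearMap.toSpanSingleton ℂ (ℝ → E) (iteratedDeriv i y)

theorem polyDiff_apply (y : ℝ → E) (p : Polynomial ℂ) {N : ℕ} (hN : p.natDegree < N) (t : ℝ) :
    polyDiff y p t = ∑ i ∈ Finset.range N, p.coeff i • iteratedDeriv i y t := by
  rw [polyDiff, Polynomial.lsum_apply, Polynomial.sum_over_range' _ (by simp) N hN]
  simp

@[simp]
theorem polyDiff_X_pow (y : ℝ → E) (i : ℕ) :
    polyDiff y (Polynomial.X ^ i) = iteratedDeriv i y := by
  rw [polyDiff, Polynomial.lsum_apply, Polynomial.X_pow_eq_monomial,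
    Polynomial.sum_monomial_index _ _ (by simp)]
  simp

@[simp]
theorem polyDiff_one (y : ℝ → E) : polyDiff y 1 = y := by
  simpa using polyDiff_X_pow y 0

theorem polyDiff_sub {p : Polynomial ℂ} {N : ℕ} (hN : p.natDegree ≤ N) {y z : ℝ → E}
    (hy : ContDiff ℝ N y) (hz : ContDiff ℝ N z) :
    polyDiff (y - z) p = polyDiff y p - polyDiff z p := by
  ext t
  simp only [Pi.sub_apply, polyDiff_apply _ p (Nat.lt_succ_of_le hN), ← Finset.sum_sub_distrib,
    ← smul_sub]
  refine Finset.sum_congr rfl fun i hi => ?_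
  have hi' : ((i : ℕ) : WithTop ℕ∞) ≤ N := by
    exact_mod_cast Finset.mem_range_succ_iff.1 hi
  rw [iteratedDeriv_sub (hy.of_le hi').contDiffAt (hz.of_le hi').contDiffAt]

theorem polyDiff_const_smul (p : Polynomial ℂ) (c : ℂ) (y : ℝ → E) :
    polyDiff (c • y) p = c • polyDiff y p := by
  ext t
  simp only [Pi.smul_apply, polyDiff_apply _ p (Nat.lt_succ_self _),
    iteratedDeriv_const_smul_field, Finset.smul_sum, smul_comm c]

theorem polyDiff_comp_add_const (p : Polynomial ℂ) (y : ℝ → E) (s : ℝ) :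
    polyDiff (fun t => y (t + s)) p = fun t => polyDiff y p (t + s) := by
  ext t
  simp only [polyDiff_apply _ p (Nat.lt_succ_self _), iteratedDeriv_comp_add_const]

theorem hasDerivAt_polyDiff {p : Polynomial ℂ} {N : ℕ} (hN : p.natDegree ≤ N) {y : ℝ → E}
    (hy : ContDiff ℝ (N + 1 : ℕ) y) (t : ℝ) :
    HasDerivAt (polyDiff y p) (polyDiff y (Polynomial.X * p) t) t := by
  have hsum : polyDiff y p =
      fun t => ∑ i ∈ Finset.range (N + 1), p.coeff i • iteratedDeriv i y t :=
    funext fun t => polyDiff_apply y p (Nat.lt_succ_of_le hN) t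
  have hX : (Polynomial.X * p).natDegree < N + 2 :=
    (Polynomial.natDegree_mul_le.trans (add_le_add Polynomial.natDegree_X_le hN)).trans_lt
      (by omega)
  rw [polyDiff_apply y _ hX, Finset.sum_range_succ', Polynomial.coeff_X_mul_zero, zero_smul,
    add_zero, hsum]
  refine HasDerivAt.fun_sum fun i hi => ?_
  rw [Polynomial.coeff_X_mul, iteratedDeriv_succ]
  refine HasDerivAt.const_smul (p.coeff i) (DifferentiableAt.hasDerivAt ?_)
  refine (hy.differentiable_iteratedDeriv i ?_).differentiableAt
  have := Finset.mem_range.1 hi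
  exact_mod_cast this

theorem polyDiff_X_sub_C_mul {p : Polynomial ℂ} {N : ℕ} (hN : p.natDegree ≤ N) {y : ℝ → E}
    (hy : ContDiff ℝ (N + 1 : ℕ) y) (r : ℂ) (t : ℝ) :
    polyDiff y ((Polynomial.X - Polynomial.C r) * p) t =
      deriv (polyDiff y p) t - r • polyDiff y p t := by
  rw [(hasDerivAt_polyDiff hN hy t).deriv, sub_mul, map_sub, ← Polynomial.smul_eq_C_mul, map_smul]
  rfl

theorem natDegree_prod_X_sub_C {ι : Type*} (s : Finset ι) (r : ι → ℂ) :
    (∏ k ∈ s, (Polynomial.X - Polynomial.C (r k))).natDegree = s.card := by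
  simp

theorem hasDerivAt_cexp_mul_ofReal (r : ℂ) (t : ℝ) :
    HasDerivAt (fun t : ℝ => Complex.exp (r * t)) (r * Complex.exp (r * t)) t := by
  have h : HasDerivAt (fun t : ℝ => r * (t : ℂ)) r t := by
    simpa using ((hasDerivAt_id t).ofReal_comp).const_mul r
  simpa [mul_comm] using h.cexp

theorem contDiff_cexp_mul_ofReal (r : ℂ) {m : WithTop ℕ∞} :
    ContDiff ℝ m (fun t : ℝ => Complex.exp (r * t)) :=
  (contDiff_const.mul Complex.ofRealCLM.contDiff).cexp

theorem polyDiff_cexp_smul (p : Polynomial ℂ) (r : ℂ) (x : E) (t : ℝ) :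
    polyDiff (fun t : ℝ => Complex.exp (r * t) • x) p t = (p.eval r * Complex.exp (r * t)) • x := by
  have hder (i : ℕ) : iteratedDeriv i (fun t : ℝ => Complex.exp (r * t) • x) =
      fun t : ℝ => (r ^ i * Complex.exp (r * t)) • x := by
    induction i with
    | zero => simp
    | succ i ih =>
      ext t
      rw [iteratedDeriv_succ, ih,
        (((hasDerivAt_cexp_mul_ofReal r t).const_mul (r ^ i)).smul_const x).deriv]
      ring_nf
  rw [polyDiff_apply _ p (Nat.lt_succ_self _), Polynomial.eval_eq_sum_range, Finset.sum_mul,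
    Finset.sum_smul]
  simp only [hder, smul_smul, mul_assoc]

/-- A differentiable solution of `v' = r v` is multiplied by `exp r` under a unit shift. -/
theorem apply_add_one_of_deriv_eq_smul {v : ℝ → E} {r : ℂ} (hv : Differentiable ℝ v)
    (h : ∀ t, deriv v t = r • v t) (t : ℝ) : v (t + 1) = Complex.exp r • v t := by
  have hg (t : ℝ) : HasDerivAt (fun t : ℝ => Complex.exp (-r * t) • v t) 0 t := by
    have := (hasDerivAt_cexp_mul_ofReal (-r) t).smul (hv t).hasDerivAt
    rw [h, smul_smul, ← add_smul] at this
    refine this.congr_deriv ?_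
    ring_nf
    simp
  have hconst := is_const_of_deriv_eq_zero (fun t => (hg t).differentiableAt)
    (fun t => (hg t).deriv) (t + 1) t
  have := congrArg (fun x => Complex.exp (r * ↑(t + 1)) • x) hconst
  simp only [smul_smul, ← Complex.exp_add] at this
  convert this using 2 <;> push_cast <;> ring_nf
  simp

/-- A bounded function multiplied by `exp r` under a unit shift vanishes when `Re r ≠ 0`. -/
theorem eq_zero_of_apply_add_one {z : ℝ → E} {r : ℂ} (hr : r.re ≠ 0) {M : ℝ}
    (hM : ∀ t, ‖z t‖ ≤ M) (h : ∀ t, z (t + 1) = Complex.exp r • z t) (t : ℝ) : z t = 0 := by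
  have hnorm (m : ℕ) (t : ℝ) : ‖z (t + m)‖ = Real.exp r.re ^ m * ‖z t‖ := by
    induction m with
    | zero => simp
    | succ m ih =>
      rw [Nat.cast_succ, ← add_assoc, h, norm_smul, ih, Complex.norm_exp, pow_succ]
      ring
  rcases hr.lt_or_gt with hr | hr
  · refine eq_zero_of_norm_mul_pow_le (q := (Real.exp r.re)⁻¹) (M := M)
      ((one_lt_inv₀ (Real.exp_pos _)).2 (by simpa using hr)) fun m => ?_
    have := hnorm m (t - m)
    rw [sub_add_cancel] at this
    rw [this, inv_pow, mul_right_comm, mul_inv_cancel₀ (pow_pos (Real.exp_pos _) m).ne', one_mul]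
    exact hM _
  · refine eq_zero_of_norm_mul_pow_le (q := Real.exp r.re) (M := M)
      (Real.one_lt_exp_iff.2 hr) fun m => ?_
    rw [mul_comm, ← hnorm]
    exact hM _

/-- A differential operator without purely imaginary roots has no nonzero bounded solutions. -/
theorem eq_zero_of_polyDiff_prod_eq_zero {ι : Type*} (s : Finset ι) (r : ι → ℂ)
    (hr : ∀ k ∈ s, (r k).re ≠ 0) {z : ℝ → E} (hz : ContDiff ℝ s.card z)
    (hD : polyDiff z (∏ k ∈ s, (Polynomial.X - Polynomial.C (r k))) = 0) {M : ℝ}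
    (hM : ∀ t, ‖z t‖ ≤ M) : z = 0 := by
  classical
  induction s using Finset.induction_on generalizing z M with
  | empty => simpa using hD
  | insert j s hj ih =>
    rw [Finset.prod_insert hj] at hD
    rw [Finset.card_insert_of_notMem hj] at hz
    have hN := (natDegree_prod_X_sub_C s r).le
    set p := ∏ k ∈ s, (Polynomial.X - Polynomial.C (r k))
    have hz' : ContDiff ℝ s.card z := hz.of_le (by exact_mod_cast Nat.le_succ _)
    have hshift : ContDiff ℝ s.card (fun t => z (t + 1)) :=
      hz'.comp (contDiff_id.add contDiff_const)
    have hcz : ContDiff ℝ s.card (Complex.exp (r j) • z) := contDiff_const.smul hz'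
    have hv (t : ℝ) : polyDiff z p (t + 1) = Complex.exp (r j) • polyDiff z p t := by
      refine apply_add_one_of_deriv_eq_smul
        (fun t => (hasDerivAt_polyDiff hN hz t).differentiableAt) (fun t => ?_) t
      rw [← sub_eq_zero, ← polyDiff_X_sub_C_mul hN hz, hD, Pi.zero_apply]
    have hT := ih (fun k hk => hr k (Finset.mem_insert_of_mem hk))
      (z := (fun t => z (t + 1)) - Complex.exp (r j) • z)
      (hshift.sub hcz)
      (by
        rw [polyDiff_sub hN hshift hcz, polyDiff_const_smul,
          polyDiff_comp_add_const]
        ext t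
        simp [hv])
      (M := M + ‖Complex.exp (r j)‖ * M)
      (fun t => (norm_sub_le _ _).trans (add_le_add (hM _) (by
        rw [Pi.smul_apply, norm_smul]
        exact mul_le_mul_of_nonneg_left (hM t) (norm_nonneg _))))
    ext t
    exact eq_zero_of_apply_add_one (hr j (Finset.mem_insert_self _ _)) hM
      (fun t => sub_eq_zero.1 (congrFun hT t)) t

theorem exists_bounded_solution_of_re_pos [CompleteSpace E] {r : ℂ} (hr : 0 < r.re) {m : ℕ}
    {f : ℝ → E} (hf : ContDiff ℝ m f) {ε : ℝ} (hε : ∀ t, ‖f t‖ ≤ ε) :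
    ∃ u : ℝ → E, ContDiff ℝ (m + 1 : ℕ) u ∧ (∀ t, deriv u t - r • u t = f t) ∧
      ∀ t, ‖u t‖ ≤ ε / |r.re| := by
  set g : ℝ → E := fun s => Complex.exp (-r * s) • f s with hg
  have hgc : ContDiff ℝ m g := (contDiff_cexp_mul_ofReal (-r)).smul hf
  have hgn (s : ℝ) : ‖g s‖ ≤ ε * Real.exp (-r.re * s) := by
    rw [hg, norm_smul, Complex.norm_exp, mul_comm]
    simpa using mul_le_mul_of_nonneg_right (hε s) (Real.exp_pos _).le
  have hint (c : ℝ) : IntegrableOn (fun s : ℝ => ε * Real.exp (-r.re * s)) (Set.Ioi c) :=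
    (integrableOn_exp_mul_Ioi (neg_lt_zero.2 hr) c).const_mul ε
  have hgi (c : ℝ) : IntegrableOn g (Set.Ioi c) :=
    (hint c).mono' hgc.continuous.aestronglyMeasurable (Filter.Eventually.of_forall hgn)
  set I : ℝ → E := fun t => ∫ s in Set.Ioi t, g s with hI
  have hder (t : ℝ) : HasDerivAt I (-g t) t := by
    have heq : I = fun t => I 0 - ∫ s in (0 : ℝ)..t, g s := by
      ext t
      rw [eq_sub_iff_add_eq', hI]
      exact intervalIntegral.integral_interval_add_Ioi (hgi 0) (hgi t)
    rw [heq]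
    exact (hgc.continuous.integral_hasStrictDerivAt 0 t).hasDerivAt.const_sub _
  have hIc : ContDiff ℝ (m + 1 : ℕ) I := by
    push_cast
    refine contDiff_succ_iff_deriv.2 ⟨fun t => (hder t).differentiableAt, by simp, ?_⟩
    rw [show deriv I = fun t => -g t from funext fun t => (hder t).deriv]
    exact hgc.neg
  refine ⟨fun t => -(Complex.exp (r * t) • I t),
    ((contDiff_cexp_mul_ofReal r).smul hIc).neg, fun t => ?_, fun t => ?_⟩
  · have hu : HasDerivAt (fun t : ℝ => -(Complex.exp (r * t) • I t)) _ t :=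
      ((hasDerivAt_cexp_mul_ofReal r t).smul (hder t)).neg
    rw [hu.deriv]
    simp only [hg, smul_neg, neg_add_rev, smul_smul, ← Complex.exp_add]
    simp
  · have hIn : ‖I t‖ ≤ ε * (Real.exp (-r.re * t) / r.re) := by
      refine (norm_integral_le_of_norm_le (hint t) (Filter.Eventually.of_forall hgn)).trans_eq ?_
      rw [integral_const_mul, integral_exp_mul_Ioi (neg_lt_zero.2 hr), neg_div_neg_eq]
    rw [norm_neg, norm_smul, Complex.norm_exp, abs_of_pos hr]
    have hre : (r * t).re = r.re * t := by simp
    rw [hre]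
    refine (mul_le_mul_of_nonneg_left hIn (Real.exp_pos _).le).trans_eq ?_
    rw [neg_mul, Real.exp_neg]
    field_simp

theorem exists_bounded_solution [CompleteSpace E] {r : ℂ} (hr : r.re ≠ 0) {m : ℕ}
    {f : ℝ → E} (hf : ContDiff ℝ m f) {ε : ℝ} (hε : ∀ t, ‖f t‖ ≤ ε) :
    ∃ u : ℝ → E, ContDiff ℝ (m + 1 : ℕ) u ∧ (∀ t, deriv u t - r • u t = f t) ∧
      ∀ t, ‖u t‖ ≤ ε / |r.re| := by
  rcases hr.lt_or_gt with hr | hr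
  · obtain ⟨u, hu, hD, hb⟩ := exists_bounded_solution_of_re_pos (r := -r) (by simpa using hr)
      (f := fun t => -f (-t)) (hf.comp contDiff_neg).neg (ε := ε) (fun t => by simpa using hε (-t))
    refine ⟨fun t => u (-t), hu.comp contDiff_neg, fun t => ?_, fun t => by simpa using hb (-t)⟩
    have := hD (-t)
    rw [neg_neg] at this
    rw [deriv_comp_neg, ← neg_inj, ← this]
    module
  · exact exists_bounded_solution_of_re_pos hr hf hε

/-- Inverting the operator with roots `r k` off the imaginary axis on bounded functions costs a
factor `1 / ∏ |Re r k|`. -/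
theorem exists_bounded_polyDiff_prod_eq [CompleteSpace E] {ι : Type*} (s : Finset ι) (r : ι → ℂ)
    (hr : ∀ k ∈ s, (r k).re ≠ 0) {m : ℕ} {f : ℝ → E} (hf : ContDiff ℝ m f) {ε : ℝ}
    (hε : ∀ t, ‖f t‖ ≤ ε) :
    ∃ w : ℝ → E, ContDiff ℝ (m + s.card : ℕ) w ∧
      polyDiff w (∏ k ∈ s, (Polynomial.X - Polynomial.C (r k))) = f ∧
      ∀ t, ‖w t‖ ≤ ε / ∏ k ∈ s, |(r k).re| := by
  classical
  induction s using Finset.induction_on generalizing m f ε with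
  | empty => exact ⟨f, by simpa using hf, by simp, by simpa using hε⟩
  | insert j s hj ih =>
    obtain ⟨u, hu, hD, hub⟩ := exists_bounded_solution (hr j (Finset.mem_insert_self _ _)) hf hε
    obtain ⟨w, hw, hwD, hwb⟩ := ih (fun k hk => hr k (Finset.mem_insert_of_mem hk)) hu hub
    rw [Finset.prod_insert hj, Finset.prod_insert hj, Finset.card_insert_of_notMem hj]
    refine ⟨w, by convert hw using 2; omega, ?_, fun t => by rw [← div_div]; exact hwb t⟩
    ext t
    rw [polyDiff_X_sub_C_mul (natDegree_prod_X_sub_C s r).le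
      (hw.of_le (by exact_mod_cast (by omega))), hwD, hD]

theorem Dop_eq_polyDiff (n : ℕ) (a : Fin n → ℂ) (y : ℝ → E) :
    Dop n a y = polyDiff y (Polynomial.X ^ n +
      ∑ j : Fin n, Polynomial.C (a j) * Polynomial.X ^ (n - 1 - (j : ℕ))) := by
  ext t
  simp only [Dop, map_add, map_sum, ← Polynomial.smul_eq_C_mul, map_smul, polyDiff_X_pow,
    Pi.add_apply, Finset.sum_apply, Pi.smul_apply]

end LinearODE

theorem charPoly_eq_prod (n : ℕ) (a : Fin (n + 1) → ℂ) (r : Fin (n + 1) → ℂ)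
    (hroot : ∀ k, r k ^ (n + 1) + ∑ j : Fin (n + 1), a j * r k ^ (n - (j : ℕ)) = 0)
    (hinj : Function.Injective r) :
    Polynomial.X ^ (n + 1) +
      ∑ j : Fin (n + 1), Polynomial.C (a j) * Polynomial.X ^ (n + 1 - 1 - (j : ℕ)) =
    ∏ k : Fin (n + 1), (Polynomial.X - Polynomial.C (r k)) := by
  have hlow : (∑ j : Fin (n + 1),
      Polynomial.C (a j) * Polynomial.X ^ (n + 1 - 1 - (j : ℕ))).degree <
      ((n + 1 : ℕ) : WithBot ℕ) := by
    refine (Polynomial.degree_sum_le _ _).trans_lt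
      ((Finset.sup_lt_iff (WithBot.bot_lt_coe _)).2 fun j _ => ?_)
    exact (Polynomial.degree_C_mul_X_pow_le _ _).trans_lt (by exact_mod_cast (by omega))
  have hmonic := Polynomial.monic_X_pow_add hlow
  have hdeg : (Polynomial.X ^ (n + 1) +
      ∑ j : Fin (n + 1), Polynomial.C (a j) * Polynomial.X ^ (n + 1 - 1 - (j : ℕ))).degree
      = ((n + 1 : ℕ) : WithBot ℕ) := by
    rw [Polynomial.degree_add_eq_left_of_degree_lt] <;> rw [Polynomial.degree_X_pow]
    exact hlow
  refine Polynomial.eq_of_degree_sub_lt_of_eval_index_eq Finset.univ (v := r) hinj.injOn ?_ ?_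
  · have hprod : (∏ k : Fin (n + 1), (Polynomial.X - Polynomial.C (r k))).Monic :=
      Polynomial.monic_prod_X_sub_C r Finset.univ
    refine (Polynomial.degree_sub_lt_left ?_ hmonic.ne_zero ?_).trans_eq ?_
    · rw [hdeg, Polynomial.degree_eq_natDegree hprod.ne_zero, natDegree_prod_X_sub_C]
      simp
    · rw [hmonic.leadingCoeff, hprod.leadingCoeff]
    · rw [hdeg]
      simp
  · intro k _
    rw [Polynomial.eval_prod, Finset.prod_eq_zero (Finset.mem_univ k) (by simp)]
    simpa [Polynomial.eval_finsetSum] using hroot k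

theorem stmt11 {X : Type*} [NormedAddCommGroup X] [NormedSpace ℂ X] [CompleteSpace X]
    [Nontrivial X]
    (n : ℕ) (a : Fin (n + 1) → ℂ) (r : Fin (n + 1) → ℂ)
    (ρ : Fin (n + 1) → ℝ) (α : ℝ)
    (hform : ∀ k, r k = (ρ k : ℂ) + (α : ℂ) * Complex.I)
    (hρ : ∀ k, ρ k ≠ 0)
    (hroot : ∀ k, r k ^ (n + 1) + ∑ j : Fin (n + 1), a j * r k ^ (n - (j : ℕ)) = 0)
    (hinj : Function.Injective r) :
    IsUlamConstant (X := X) (n + 1) a (1 / ∏ k : Fin (n + 1), |(r k).re|) ∧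
      ∀ K : ℝ, IsUlamConstant (X := X) (n + 1) a K →
        1 / ∏ k : Fin (n + 1), |(r k).re| ≤ K := by
  have hre (k : Fin (n + 1)) : (r k).re = ρ k := by simp [hform]
  have hr (k : Fin (n + 1)) : (r k).re ≠ 0 := by simpa [hre] using hρ k
  have hDop (y : ℝ → X) : Dop (n + 1) a y =
      polyDiff y (∏ k : Fin (n + 1), (Polynomial.X - Polynomial.C (r k))) := by
    rw [Dop_eq_polyDiff, charPoly_eq_prod n a r hroot hinj]
  have hN : (∏ k : Fin (n + 1), (Polynomial.X - Polynomial.C (r k))).natDegree ≤ n + 1 := by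
    simp
  have hpos : 0 < ∏ k : Fin (n + 1), |(r k).re| :=
    Finset.prod_pos fun k _ => abs_pos.2 (hr k)
  refine ⟨⟨by positivity, fun ε _ y hy hyε => ?_⟩, fun K hK => ?_⟩
  · have hcont : Continuous (Dop (n + 1) a y) := by
      refine (hy.continuous_iteratedDeriv (n + 1) le_rfl).add
        (continuous_finsetSum _ fun j _ =>
          (hy.continuous_iteratedDeriv _ (by exact_mod_cast (by omega))).const_smul (a j))
    obtain ⟨w, hw, hwD, hwb⟩ := exists_bounded_polyDiff_prod_eq Finset.univ r (fun k _ => hr k)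
      (m := 0) (contDiff_zero.2 hcont) hyε
    have hw' : ContDiff ℝ (n + 1 : ℕ) w := by simpa using hw
    refine ⟨y - w, hy.sub hw', ?_, fun t => ?_⟩
    · rw [hDop, polyDiff_sub hN hy hw', hwD, hDop, sub_self]
    · rw [Pi.sub_apply, sub_sub_cancel, one_div_mul_eq_div]
      exact hwb t
  · obtain ⟨x, hx⟩ := exists_norm_eq X zero_le_one
    set y : ℝ → X := fun t => Complex.exp ((α * Complex.I) * t) • x with hy
    have hyc : ContDiff ℝ (n + 1 : ℕ) y := (contDiff_cexp_mul_ofReal _).smul contDiff_const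
    have hyn (t : ℝ) : ‖y t‖ = 1 := by
      rw [hy, norm_smul, hx, Complex.norm_exp]
      simp
    obtain ⟨z, hz, hzD, hyz⟩ := hK.2 (∏ k : Fin (n + 1), |(r k).re|) hpos y hyc (fun t => by
      rw [hDop, polyDiff_cexp_smul, mul_smul, norm_smul]
      change _ * ‖y t‖ ≤ _
      rw [hyn, Polynomial.eval_prod, norm_prod, mul_one]
      refine Finset.prod_le_prod (fun _ _ => norm_nonneg _) fun k _ => ?_
      rw [hre, hform]
      simp)
    have hz0 : z = 0 := by
      refine eq_zero_of_polyDiff_prod_eq_zero Finset.univ r (fun k _ => hr k) (by simpa using hz)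
        (by rw [← hDop, hzD]) (M := 1 + K * ∏ k : Fin (n + 1), |(r k).re|) fun t => ?_
      have := norm_le_norm_add_norm_sub (y t) (z t)
      rw [hyn] at this
      exact this.trans (by gcongr; exact hyz t)
    have h0 := hyz 0
    rw [hz0, Pi.zero_apply, sub_zero, hyn] at h0
    rwa [div_le_iff₀ hpos]
end

section
/- Let D(y) = y″ + a₁y′ + a₂y with a₁, a₂ ∈ ℝ∖{0} and a₁² − 4a₂ ≥ 0, and suppose the roots r₁, r₂ of z² + a₁z + a₂ = 0 are distinct (and, being real and nonzero, off the imaginary axis). Then the best Ulam constant of D equals 1/|a₂|. -/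
open MeasureTheory

/-- The second order linear differential operator `D(y) = y″ + a₁ y′ + a₂ y`. -/
noncomputable def Dop2 {X : Type*} [NormedAddCommGroup X] [NormedSpace ℂ X]
    (a₁ a₂ : ℂ) (y : ℝ → X) : ℝ → X :=
  fun t => iteratedDeriv 2 y t + a₁ • deriv y t + a₂ • y t

/-- `K` is an Ulam constant of the operator `D(y) = y″ + a₁ y′ + a₂ y`. -/
def IsUlamConstant2 {X : Type*} [NormedAddCommGroup X] [NormedSpace ℂ X]
    (a₁ a₂ : ℂ) (K : ℝ) : Prop :=
  0 ≤ K ∧ ∀ ε : ℝ, 0 < ε → ∀ y : ℝ → X, ContDiff ℝ 2 y →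
    (∀ t : ℝ, ‖Dop2 a₁ a₂ y t‖ ≤ ε) →
    ∃ z : ℝ → X, ContDiff ℝ 2 z ∧ Dop2 a₁ a₂ z = 0 ∧ ∀ t : ℝ, ‖y t - z t‖ ≤ K * ε

section FirstOrder

variable {E : Type*} [NormedAddCommGroup E] [NormedSpace ℝ E]

theorem hasDerivAt_exp_const_mul (r t : ℝ) :
    HasDerivAt (fun t => Real.exp (r * t)) (r * Real.exp (r * t)) t := by
  simpa [mul_comm] using ((hasDerivAt_id t).const_mul r).exp

theorem exists_norm_sub_exp_smul_le_of_pos [CompleteSpace E] {r ε : ℝ} (hr : 0 < r) {y y' : ℝ → E}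
    (hy : ∀ t, HasDerivAt y (y' t) t) (h : ∀ t, ‖y' t - r • y t‖ ≤ ε) :
    ∃ c : E, ∀ t, ‖y t - Real.exp (r * t) • c‖ ≤ ε / r := by
  have hε : 0 ≤ ε := (norm_nonneg _).trans (h 0)
  set f : ℝ → E := fun t => Real.exp (-r * t) • y t with hf
  have hfd : ∀ t, HasDerivAt f (Real.exp (-r * t) • (y' t - r • y t)) t := fun t =>
    ((hasDerivAt_exp_const_mul (-r) t).smul (hy t)).congr_deriv (by module)
  have hfb : ∀ a b, a ≤ b → ‖f b - f a‖ ≤ ε / r * Real.exp (-r * a) := fun a b hab => by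
    have hB : ∀ t, HasDerivAt
        (fun t => ε / r * Real.exp (-r * a) - ε / r * Real.exp (-r * t))
        (ε * Real.exp (-r * t)) t := fun t =>
      (((hasDerivAt_exp_const_mul (-r) t).const_mul (ε / r)).const_sub
        (ε / r * Real.exp (-r * a))).congr_deriv (by field_simp)
    have key := image_norm_le_of_norm_deriv_right_le_deriv_boundary
      (f := fun t => f t - f a) (a := a) (b := b)
      (fun t _ => ((hfd t).sub_const (f a)).continuousAt.continuousWithinAt)
      (fun t _ => ((hfd t).sub_const (f a)).hasDerivWithinAt) (by simp) hB
      (fun t _ => by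
        rw [norm_smul, Real.norm_of_nonneg (Real.exp_pos _).le, mul_comm]
        gcongr
        exact h t) (Set.right_mem_Icc.2 hab)
    have : 0 ≤ ε / r * Real.exp (-r * b) := by positivity
    linarith
  have hlim : Filter.Tendsto (fun t => ε / r * Real.exp (-r * t)) Filter.atTop (nhds 0) := by
    have h₁ : Filter.Tendsto (fun t : ℝ => -r * t) Filter.atTop Filter.atBot :=
      Filter.tendsto_id.const_mul_atTop_of_neg (neg_neg_of_pos hr)
    simpa using (Real.tendsto_exp_atBot.comp h₁).const_mul (ε / r)
  have hc : CauchySeq f := cauchySeq_of_le_tendsto_0' _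
    (fun a b hab => by rw [dist_comm, dist_eq_norm]; exact hfb a b hab) hlim
  obtain ⟨c, hc⟩ := cauchySeq_tendsto_of_complete hc
  refine ⟨c, fun t => ?_⟩
  have hle : ‖c - f t‖ ≤ ε / r * Real.exp (-r * t) :=
    le_of_tendsto (hc.sub_const (f t)).norm
      ((Filter.eventually_ge_atTop t).mono fun b hb => hfb t b hb)
  have hexp : Real.exp (r * t) * Real.exp (-r * t) = 1 := by
    rw [← Real.exp_add]; simp
  have heq : y t - Real.exp (r * t) • c = -(Real.exp (r * t) • (c - f t)) := by
    rw [smul_sub, hf, smul_smul, hexp, one_smul, neg_sub]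
  rw [heq, norm_neg, norm_smul, Real.norm_of_nonneg (Real.exp_pos _).le]
  calc Real.exp (r * t) * ‖c - f t‖
      ≤ Real.exp (r * t) * (ε / r * Real.exp (-r * t)) := by gcongr
    _ = ε / r * (Real.exp (r * t) * Real.exp (-r * t)) := by ring
    _ = ε / r := by rw [hexp, mul_one]

theorem exists_norm_sub_exp_smul_le [CompleteSpace E] {r ε : ℝ} (hr : r ≠ 0) {y y' : ℝ → E}
    (hy : ∀ t, HasDerivAt y (y' t) t) (h : ∀ t, ‖y' t - r • y t‖ ≤ ε) :
    ∃ c : E, ∀ t, ‖y t - Real.exp (r * t) • c‖ ≤ ε / |r| := by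
  rcases hr.lt_or_gt with hr | hr
  · obtain ⟨c, hc⟩ := exists_norm_sub_exp_smul_le_of_pos (r := -r) (ε := ε) (neg_pos.2 hr)
      (y := fun t => y (-t)) (y' := fun t => -y' (-t))
      (fun t => ((hy (-t)).scomp t (hasDerivAt_neg t)).congr_deriv (by simp))
      (fun t => by
        have heq : -y' (-t) - -r • y (-t) = -(y' (-t) - r • y (-t)) := by module
        rw [heq, norm_neg]
        exact h (-t))
    exact ⟨c, fun t => by simpa [abs_of_neg hr] using hc (-t)⟩
  · rw [abs_of_pos hr]
    exact exists_norm_sub_exp_smul_le_of_pos hr hy h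

theorem exists_eq_exp_smul [CompleteSpace E] {r : ℝ} (hr : r ≠ 0) {y : ℝ → E}
    (hy : ∀ t, HasDerivAt y (r • y t) t) : ∃ c : E, ∀ t, y t = Real.exp (r * t) • c := by
  obtain ⟨c, hc⟩ := exists_norm_sub_exp_smul_le (ε := 0) hr hy (by simp)
  exact ⟨c, fun t => sub_eq_zero.1 (norm_le_zero_iff.1 (by simpa using hc t))⟩

theorem eq_zero_of_norm_exp_smul_le {s B : ℝ} (hs : s ≠ 0) {d : E}
    (h : ∀ t, ‖Real.exp (s * t) • d‖ ≤ B) : d = 0 := by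
  have hb : ∀ x : ℝ, ‖d‖ ≤ Real.exp (-x) * B := fun x => by
    have := h (x / s)
    rw [mul_div_cancel₀ _ hs, norm_smul, Real.norm_of_nonneg (Real.exp_pos _).le] at this
    rw [Real.exp_neg, ← div_eq_inv_mul, le_div_iff₀ (Real.exp_pos _), mul_comm]
    exact this
  have hlim := Real.tendsto_exp_neg_atTop_nhds_zero.mul_const B
  rw [zero_mul] at hlim
  exact norm_le_zero_iff.1 (ge_of_tendsto' hlim hb)

theorem eq_zero_of_norm_exp_smul_add_exp_smul_le {r s B : ℝ} (hs : s ≠ 0) (hrs : r ≠ s) {c d : E}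
    (h : ∀ t, ‖Real.exp (r * t) • c + Real.exp (s * t) • d‖ ≤ B) : d = 0 := by
  have hd : (Real.exp s - Real.exp r) • d = 0 := by
    refine eq_zero_of_norm_exp_smul_le (B := B + Real.exp r * B) hs fun t => ?_
    have heq : Real.exp (s * t) • (Real.exp s - Real.exp r) • d =
        (Real.exp (r * (t + 1)) • c + Real.exp (s * (t + 1)) • d) -
          Real.exp r • (Real.exp (r * t) • c + Real.exp (s * t) • d) := by
      simp only [mul_add, mul_one, Real.exp_add]
      module
    rw [heq]
    refine (norm_sub_le _ _).trans (add_le_add (h _) ?_)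
    rw [norm_smul, Real.norm_of_nonneg (Real.exp_pos _).le]
    gcongr
    exact h t
  refine (smul_eq_zero.1 hd).resolve_left fun h0 => hrs ?_
  exact (Real.exp_injective (sub_eq_zero.1 h0)).symm

end FirstOrder

section SecondOrder

variable {X : Type*} [NormedAddCommGroup X] [NormedSpace ℂ X]

theorem Dop2_apply_of_hasDerivAt {r s t : ℝ} {y y' : ℝ → X} {y'' : X}
    (hy : ∀ t, HasDerivAt y (y' t) t) (hy' : HasDerivAt y' y'' t) :
    Dop2 ((-(r + s) : ℝ) : ℂ) ((r * s : ℝ) : ℂ) y t = y'' - (r + s) • y' t + (r * s) • y t := by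
  have h : deriv y = y' := funext fun t => (hy t).deriv
  rw [Dop2, iteratedDeriv_succ, iteratedDeriv_one, h, hy'.deriv, Complex.coe_smul,
    Complex.coe_smul, neg_smul, sub_eq_add_neg]

theorem ContDiff.hasDerivAt_and_hasDerivAt_deriv {y : ℝ → X} (hy : ContDiff ℝ 2 y) (t : ℝ) :
    HasDerivAt y (deriv y t) t ∧ HasDerivAt (deriv y) (deriv (deriv y) t) t :=
  ⟨(hy.differentiable (by norm_num) t).hasDerivAt,
    (((contDiff_succ_iff_deriv (n := 1)).1 hy).2.2.differentiable (by norm_num) t).hasDerivAt⟩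

theorem Dop2_exp_smul_add_exp_smul (r s : ℝ) (c d : X) :
    Dop2 ((-(r + s) : ℝ) : ℂ) ((r * s : ℝ) : ℂ)
      (fun t => Real.exp (r * t) • c + Real.exp (s * t) • d) = 0 := by
  funext t
  rw [Dop2_apply_of_hasDerivAt (y := fun t => Real.exp (r * t) • c + Real.exp (s * t) • d)
    (y' := fun t => (r * Real.exp (r * t)) • c + (s * Real.exp (s * t)) • d)
    (fun t => ((hasDerivAt_exp_const_mul r t).smul_const c).add
      ((hasDerivAt_exp_const_mul s t).smul_const d))
    ((((hasDerivAt_exp_const_mul r t).const_mul r).smul_const c).add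
      (((hasDerivAt_exp_const_mul s t).const_mul s).smul_const d)), Pi.zero_apply]
  module

theorem hasDerivAt_deriv_sub_smul {y : ℝ → X} (hy : ContDiff ℝ 2 y) (r s t : ℝ) :
    HasDerivAt (fun t => deriv y t - s • y t)
      (Dop2 ((-(r + s) : ℝ) : ℂ) ((r * s : ℝ) : ℂ) y t + r • (deriv y t - s • y t)) t := by
  obtain ⟨h₁, h₂⟩ := hy.hasDerivAt_and_hasDerivAt_deriv t
  refine (h₂.sub (h₁.const_smul s)).congr_deriv ?_
  rw [Dop2_apply_of_hasDerivAt (fun t => (hy.hasDerivAt_and_hasDerivAt_deriv t).1) h₂]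
  module

theorem isUlamConstant2_of_real_roots [CompleteSpace X] {r s : ℝ} (hr : r ≠ 0) (hs : s ≠ 0)
    (hrs : r ≠ s) :
    IsUlamConstant2 (X := X) ((-(r + s) : ℝ) : ℂ) ((r * s : ℝ) : ℂ) (1 / |r * s|) := by
  refine ⟨by positivity, fun ε _ y hy hD => ?_⟩
  obtain ⟨c, hc⟩ := exists_norm_sub_exp_smul_le (ε := ε) hr (hasDerivAt_deriv_sub_smul hy r s)
    (fun t => by simpa using hD t)
  have hrs' : r - s ≠ 0 := sub_ne_zero.2 hrs
  obtain ⟨d, hd⟩ := exists_norm_sub_exp_smul_le (ε := ε / |r|) hs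
    (fun t => (hy.hasDerivAt_and_hasDerivAt_deriv t).1.sub
      ((hasDerivAt_exp_const_mul r t).smul_const ((r - s)⁻¹ • c)))
    (fun t => by
      convert hc t using 2
      simp only [Pi.sub_apply]
      match_scalars <;> field_simp; ring)
  refine ⟨fun t => Real.exp (r * t) • (r - s)⁻¹ • c + Real.exp (s * t) • d, by fun_prop,
    Dop2_exp_smul_add_exp_smul _ _ _ _, fun t => ?_⟩
  rw [← sub_sub]
  exact (hd t).trans_eq (by rw [abs_mul]; field_simp)

theorem eq_zero_of_Dop2_eq_zero_of_bounded [CompleteSpace X] {r s B : ℝ} (hr : r ≠ 0) (hs : s ≠ 0)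
    (hrs : r ≠ s) {z : ℝ → X} (hz : ContDiff ℝ 2 z)
    (hD : Dop2 ((-(r + s) : ℝ) : ℂ) ((r * s : ℝ) : ℂ) z = 0) (hB : ∀ t, ‖z t‖ ≤ B) : z = 0 := by
  obtain ⟨c, hc⟩ := exists_eq_exp_smul hr (y := fun t => deriv z t - s • z t)
    (fun t => by
    have := hasDerivAt_deriv_sub_smul hz r s t
    rw [hD] at this
    simpa using this)
  obtain ⟨d, hd⟩ := exists_eq_exp_smul hs (y := fun t => deriv z t - r • z t) (fun t => by
    have := hasDerivAt_deriv_sub_smul hz s r t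
    rw [add_comm s, mul_comm s, hD] at this
    simpa using this)
  have heq : ∀ t, (r - s) • z t = Real.exp (r * t) • c + Real.exp (s * t) • (-d) := fun t => by
    rw [smul_neg, ← hc, ← hd]
    module
  have hle : ∀ t, ‖Real.exp (r * t) • c + Real.exp (s * t) • (-d)‖ ≤ |r - s| * B := fun t => by
    rw [← heq, norm_smul, Real.norm_eq_abs]
    gcongr
    exact hB t
  have hd0 := eq_zero_of_norm_exp_smul_add_exp_smul_le hs hrs hle
  have hc0 := eq_zero_of_norm_exp_smul_add_exp_smul_le (B := |r - s| * B) hr hrs.symm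
    (fun t => (congrArg norm (add_comm _ _)).trans_le (hle t))
  funext t
  simpa [hd0, hc0, sub_eq_zero, hrs] using heq t

theorem one_div_abs_le_of_isUlamConstant2 [CompleteSpace X] [Nontrivial X] {r s K : ℝ}
    (hr : r ≠ 0) (hs : s ≠ 0) (hrs : r ≠ s)
    (hK : IsUlamConstant2 (X := X) ((-(r + s) : ℝ) : ℂ) ((r * s : ℝ) : ℂ) K) :
    1 / |r * s| ≤ K := by
  obtain ⟨x, hx⟩ := exists_norm_eq X zero_le_one
  have hne : r * s ≠ 0 := mul_ne_zero hr hs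
  obtain ⟨z, hz, hzD, hzy⟩ := hK.2 1 one_pos (fun _ => (r * s)⁻¹ • x) contDiff_const fun t => by
    rw [Dop2_apply_of_hasDerivAt (fun t => hasDerivAt_const t _) (hasDerivAt_const t 0)]
    simp [smul_smul, hne, hx, -mul_inv_rev]
  have hz0 : z = 0 := eq_zero_of_Dop2_eq_zero_of_bounded
    (B := ‖(r * s)⁻¹ • x‖ + K * 1) hr hs hrs hz hzD fun t =>
      (norm_le_norm_add_norm_sub _ _).trans (add_le_add_right (hzy t) _)
  simpa [hz0, norm_smul, hx, abs_mul, mul_comm] using hzy 0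

end SecondOrder

theorem stmt12 {X : Type*} [NormedAddCommGroup X] [NormedSpace ℂ X] [CompleteSpace X]
    [Nontrivial X]
    (a₁ a₂ : ℝ) (ha₁ : a₁ ≠ 0) (ha₂ : a₂ ≠ 0)
    (hdisc : a₁ ^ 2 - 4 * a₂ ≥ 0)
    (r₁ r₂ : ℂ)
    (hr₁ : r₁ ^ 2 + a₁ * r₁ + a₂ = 0) (hr₂ : r₂ ^ 2 + a₁ * r₂ + a₂ = 0)
    (hne : r₁ ≠ r₂) :
    IsUlamConstant2 (X := X) a₁ a₂ (1 / |a₂|) ∧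
      ∀ K : ℝ, IsUlamConstant2 (X := X) a₁ a₂ K → 1 / |a₂| ≤ K := by
  obtain ⟨r, s, hrs, rfl, rfl⟩ : ∃ r s : ℝ, r ≠ s ∧ a₁ = -(r + s) ∧ a₂ = r * s := by
    have hsq := Real.sq_sqrt hdisc
    refine ⟨(-a₁ + √(a₁ ^ 2 - 4 * a₂)) / 2, (-a₁ - √(a₁ ^ 2 - 4 * a₂)) / 2, fun h => hne ?_,
      by ring, by linarith⟩
    have h0 : √(a₁ ^ 2 - 4 * a₂) = 0 := by linarith
    rw [h0] at hsq
    have hdC : (a₁ : ℂ) ^ 2 - 4 * a₂ = 0 := by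
      exact_mod_cast (by linarith : a₁ ^ 2 - 4 * a₂ = 0)
    have double_root : ∀ z : ℂ, z ^ 2 + a₁ * z + a₂ = 0 → 2 * z + a₁ = 0 := fun z hz =>
      pow_eq_zero_iff two_ne_zero |>.1 (by linear_combination 4 * hz + hdC)
    linear_combination (double_root r₁ hr₁ - double_root r₂ hr₂) / 2
  have hr := left_ne_zero_of_mul ha₂
  have hs := right_ne_zero_of_mul ha₂
  exact ⟨isUlamConstant2_of_real_roots hr hs hrs,
    fun _ hK => one_div_abs_le_of_isUlamConstant2 hr hs hrs hK⟩
end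

section
/- Let α > 0 and β ∈ ℝ∖{0}. Then (1/(2|β|)) ∫₀^∞ e^{−αx} |e^{−iβx} − e^{iβx}| dx = (1/(α²+β²))·coth( απ/(2|β|) ). -/
open MeasureTheory

/-- The hyperbolic cotangent. -/
noncomputable def Real.coth (x : ℝ) : ℝ := Real.cosh x / Real.sinh x

theorem norm_exp_neg_I_mul_sub_exp_I_mul (β x : ℝ) :
    ‖Complex.exp (-Complex.I * β * x) - Complex.exp (Complex.I * β * x)‖ =
      2 * |Real.sin (|β| * x)| := by
  have h : Complex.exp (-Complex.I * β * x) - Complex.exp (Complex.I * β * x) =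
      -2 * Complex.I * (Real.sin (β * x) : ℝ) := by
    have h₁ : -Complex.I * β * x = ((-(β * x) : ℝ) : ℂ) * Complex.I := by push_cast; ring
    have h₂ : Complex.I * β * x = ((β * x : ℝ) : ℂ) * Complex.I := by push_cast; ring
    rw [h₁, h₂, Complex.exp_mul_I, Complex.exp_mul_I]
    push_cast
    rw [Complex.cos_neg, Complex.sin_neg]
    ring
  rw [h]
  simp only [norm_mul, norm_neg, Complex.norm_I, Complex.norm_real, Real.norm_eq_abs]
  rcases abs_choice β with hb | hb <;> simp [hb]

theorem integrableOn_exp_neg_mul_abs_sin {α : ℝ} (hα : 0 < α) (b : ℝ) :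
    IntegrableOn (fun x : ℝ => Real.exp (-α * x) * (2 * |Real.sin (b * x)|)) (Set.Ioi 0) := by
  refine Integrable.mono' ((exp_neg_integrableOn_Ioi 0 hα).mul_const 2)
    (by fun_prop) (ae_of_all _ fun x => ?_)
  rw [Real.norm_of_nonneg (by positivity)]
  gcongr
  linarith [Real.abs_sin_le_one (b * x)]

theorem integral_exp_neg_mul_abs_sin_half_period {α b : ℝ} (hα : 0 < α) (hb : 0 < b) :
    ∫ x in (0 : ℝ)..Real.pi / b, Real.exp (-α * x) * (2 * |Real.sin (b * x)|) =
      2 * b * (1 + Real.exp (-α * (Real.pi / b))) / (α ^ 2 + b ^ 2) := by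
  have hp : 0 ≤ Real.pi / b := by positivity
  have hc : α ^ 2 + b ^ 2 ≠ 0 := by positivity
  have hF : ∀ x : ℝ, HasDerivAt
      (fun x => -2 * Real.exp (-α * x) * (α * Real.sin (b * x) + b * Real.cos (b * x)) /
        (α ^ 2 + b ^ 2)) (Real.exp (-α * x) * (2 * Real.sin (b * x))) x := by
    intro x
    have h₁ : HasDerivAt (fun x : ℝ => Real.exp (-α * x)) _ x :=
      ((hasDerivAt_id x).const_mul (-α)).exp
    have h₂ : HasDerivAt (fun x : ℝ => Real.sin (b * x)) _ x :=
      ((hasDerivAt_id x).const_mul b).sin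
    have h₃ : HasDerivAt (fun x : ℝ => Real.cos (b * x)) _ x :=
      ((hasDerivAt_id x).const_mul b).cos
    refine (((h₁.const_mul (-2)).mul
      ((h₂.const_mul α).add (h₃.const_mul b))).div_const (α ^ 2 + b ^ 2)).congr_deriv ?_
    simp only [id, Pi.add_apply]
    field_simp
    ring
  have hcongr : ∫ x in (0 : ℝ)..Real.pi / b, Real.exp (-α * x) * (2 * |Real.sin (b * x)|) =
      ∫ x in (0 : ℝ)..Real.pi / b, Real.exp (-α * x) * (2 * Real.sin (b * x)) := by
    refine intervalIntegral.integral_congr fun x hx => ?_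
    rw [Set.uIcc_of_le hp] at hx
    have hx' : b * x ≤ Real.pi := by
      have := (le_div_iff₀ hb).1 hx.2
      linarith
    simp only [abs_of_nonneg (Real.sin_nonneg_of_nonneg_of_le_pi (mul_nonneg hb.le hx.1) hx')]
  rw [hcongr, intervalIntegral.integral_eq_sub_of_hasDerivAt (fun x _ => hF x)
    (Continuous.intervalIntegrable (by fun_prop) _ _), mul_div_cancel₀ Real.pi hb.ne']
  simp
  ring

theorem integral_Ioi_exp_neg_mul_abs_sin {α b : ℝ} (hα : 0 < α) (hb : 0 < b) :
    ∫ x in Set.Ioi (0 : ℝ), Real.exp (-α * x) * (2 * |Real.sin (b * x)|) =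
      2 * b / (α ^ 2 + b ^ 2) * ((1 + Real.exp (-α * (Real.pi / b))) /
        (1 - Real.exp (-α * (Real.pi / b)))) := by
  have hp : 0 < Real.pi / b := by positivity
  have hint := integrableOn_exp_neg_mul_abs_sin hα b
  have hsplit := intervalIntegral.integral_interval_add_Ioi hint
    (hint.mono_set (Set.Ioi_subset_Ioi hp.le))
  have hshift : ∫ x in Set.Ioi (Real.pi / b), Real.exp (-α * x) * (2 * |Real.sin (b * x)|) =
      Real.exp (-α * (Real.pi / b)) *
        ∫ x in Set.Ioi (0 : ℝ), Real.exp (-α * x) * (2 * |Real.sin (b * x)|) := by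
    have h := (measurePreserving_add_right volume (Real.pi / b)).setIntegral_preimage_emb
      (measurableEmbedding_addRight (Real.pi / b))
      (fun x => Real.exp (-α * x) * (2 * |Real.sin (b * x)|)) (Set.Ioi (Real.pi / b))
    rw [Set.preimage_add_const_Ioi, sub_self] at h
    rw [← h, ← integral_const_mul]
    refine integral_congr_ae (ae_of_all _ fun x => ?_)
    have hs : b * (x + Real.pi / b) = b * x + Real.pi := by field_simp
    simp only [hs, Real.sin_add_pi, abs_neg, mul_add (-α), Real.exp_add]
    ring
  rw [integral_exp_neg_mul_abs_sin_half_period hα hb, hshift] at hsplit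
  have hq : Real.exp (-α * (Real.pi / b)) < 1 := by
    rw [Real.exp_lt_one_iff]
    nlinarith [mul_pos hα hp]
  have hq' : 1 - Real.exp (-α * (Real.pi / b)) ≠ 0 := by linarith
  rw [← mul_div_assoc, eq_div_iff hq']
  linear_combination -hsplit

theorem Real.coth_half_eq (y : ℝ) :
    Real.coth (y / 2) = (1 + Real.exp (-y)) / (1 - Real.exp (-y)) := by
  have h₁ : Real.exp (-y) = Real.exp (-(y / 2)) * Real.exp (-(y / 2)) := by
    rw [← Real.exp_add]; ring_nf
  have h₂ : Real.exp (y / 2) * Real.exp (-(y / 2)) = 1 := by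
    rw [← Real.exp_add]; simp
  have hn : 1 + Real.exp (-y) = Real.cosh (y / 2) * (2 * Real.exp (-(y / 2))) := by
    rw [Real.cosh_eq, h₁]; linear_combination -h₂
  have hd : 1 - Real.exp (-y) = Real.sinh (y / 2) * (2 * Real.exp (-(y / 2))) := by
    rw [Real.sinh_eq, h₁]; linear_combination -h₂
  rw [hn, hd, mul_div_mul_right _ _ (by positivity), Real.coth]

theorem stmt15 (α β : ℝ) (hα : 0 < α) (hβ : β ≠ 0) :
    (1 / (2 * |β|)) * ∫ x in Set.Ioi (0 : ℝ),
        Real.exp (-α * x) *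
          ‖Complex.exp (-Complex.I * β * x) - Complex.exp (Complex.I * β * x)‖ =
      (1 / (α ^ 2 + β ^ 2)) * Real.coth (α * Real.pi / (2 * |β|)) := by
  have hb : 0 < |β| := abs_pos.mpr hβ
  have hy : α * Real.pi / (2 * |β|) = α * (Real.pi / |β|) / 2 := by field_simp
  simp only [norm_exp_neg_I_mul_sub_exp_I_mul]
  rw [integral_Ioi_exp_neg_mul_abs_sin hα hb, hy, Real.coth_half_eq, sq_abs, neg_mul, ← mul_assoc]
  congr 1
  field_simp
end

section
/- Let r₁,…,rₙ be distinct roots of the characteristic equation P(z)=0 and let f ∈ C(ℝ,X). Then the function y_P(x) = (1/V) Σ_{k=1}^n (−1)^{n+k} V_k e^{r_k x} ∫₀^x f(t) e^{−r_k t} dt belongs to Cⁿ(ℝ,X) and satisfies D(y_P) = f; in particular D is surjective onto C(ℝ,X). -/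
open MeasureTheory intervalIntegral

/-- Vandermonde determinant of `r₁, …, rₙ` with the `k`-th entry deleted. -/
noncomputable def VandDel {n : ℕ} (r : Fin (n + 1) → ℂ) (k : Fin (n + 1)) : ℂ :=
  (Matrix.vandermonde fun i : Fin n => r (k.succAbove i)).det

/-- The solution of `u' = c u + f` vanishing at `0`. -/
noncomputable def firstOrderSolution {X : Type*} [NormedAddCommGroup X] [NormedSpace ℂ X]
    (c : ℂ) (f : ℝ → X) (x : ℝ) : X :=
  Complex.exp (c * x) • ∫ t in (0 : ℝ)..x, Complex.exp (-c * t) • f t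

theorem hasDerivAt_firstOrderSolution {X : Type*} [NormedAddCommGroup X] [NormedSpace ℂ X]
    [CompleteSpace X] (c : ℂ) {f : ℝ → X} (hf : Continuous f) (x : ℝ) :
    HasDerivAt (firstOrderSolution c f) (c • firstOrderSolution c f x + f x) x := by
  have hcont : Continuous fun t : ℝ => Complex.exp (-c * t) • f t := by fun_prop
  have hexp : HasDerivAt (fun x : ℝ => Complex.exp (c * x)) (Complex.exp (c * x) * (c * 1)) x :=
    ((Complex.ofRealCLM.hasDerivAt (x := x)).const_mul c).cexp
  refine (hexp.smul (hcont.integral_hasStrictDerivAt 0 x).hasDerivAt).congr_deriv ?_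
  have h : Complex.exp (c * x) * Complex.exp (-c * x) = 1 := by
    rw [← Complex.exp_add]
    simp
  rw [smul_smul, h, one_smul, firstOrderSolution, smul_smul, mul_one,
    mul_comm (Complex.exp (c * x)), add_comm]

theorem hasDerivAt_sum_smul_firstOrderSolution {X ι : Type*} [NormedAddCommGroup X]
    [NormedSpace ℂ X] [CompleteSpace X] [Fintype ι] (r c : ι → ℂ) {f : ℝ → X}
    (hf : Continuous f) (x : ℝ) :
    HasDerivAt (fun x => ∑ k, c k • firstOrderSolution (r k) f x)
      (∑ k, (c k * r k) • firstOrderSolution (r k) f x + (∑ k, c k) • f x) x := by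
  refine (HasDerivAt.fun_sum fun k _ =>
    (hasDerivAt_firstOrderSolution (r k) hf x).const_smul (c k)).congr_deriv ?_
  simp_rw [smul_add, smul_smul, Finset.sum_add_distrib, Finset.sum_smul]

theorem continuous_sum_smul_firstOrderSolution {X ι : Type*} [NormedAddCommGroup X]
    [NormedSpace ℂ X] [CompleteSpace X] [Fintype ι] (r c : ι → ℂ) {f : ℝ → X}
    (hf : Continuous f) :
    Continuous fun x => ∑ k, c k • firstOrderSolution (r k) f x :=
  continuous_iff_continuousAt.2 fun x =>
    (hasDerivAt_sum_smul_firstOrderSolution r c hf x).continuousAt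

theorem contDiff_sum_smul_firstOrderSolution {X ι : Type*} [NormedAddCommGroup X]
    [NormedSpace ℂ X] [CompleteSpace X] [Fintype ι] (r : ι → ℂ) {f : ℝ → X}
    (hf : Continuous f) (n : ℕ) (c : ι → ℂ) (hc : ∀ j < n, ∑ k, c k * r k ^ j = 0) :
    ContDiff ℝ (n + 1) fun x => ∑ k, c k • firstOrderSolution (r k) f x := by
  have hd := hasDerivAt_sum_smul_firstOrderSolution r c hf
  induction n generalizing c with
  | zero =>
    rw [Nat.cast_zero, zero_add, contDiff_one_iff_deriv]
    refine ⟨fun x => (hd x).differentiableAt, ?_⟩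
    rw [funext fun x => (hd x).deriv]
    exact (continuous_sum_smul_firstOrderSolution r (fun k => c k * r k) hf).add (by fun_prop)
  | succ n ih =>
    rw [contDiff_succ_iff_deriv]
    refine ⟨fun x => (hd x).differentiableAt, by simp, ?_⟩
    have h0 : ∑ k, c k = 0 := by simpa using hc 0 n.succ_pos
    simp_rw [h0, zero_smul, add_zero] at hd
    rw [funext fun x => (hd x).deriv, Nat.cast_succ]
    refine ih _ (fun j hj => ?_) (hasDerivAt_sum_smul_firstOrderSolution r _ hf)
    simpa only [pow_succ', mul_assoc] using hc (j + 1) (by lia)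

theorem iteratedDeriv_sum_smul_firstOrderSolution {X ι : Type*} [NormedAddCommGroup X]
    [NormedSpace ℂ X] [CompleteSpace X] [Fintype ι] (r c : ι → ℂ) {f : ℝ → X}
    (hf : Continuous f) (n : ℕ) (hc : ∀ j < n, ∑ k, c k * r k ^ j = 0) :
    iteratedDeriv n (fun x => ∑ k, c k • firstOrderSolution (r k) f x) =
      fun x => ∑ k, (c k * r k ^ n) • firstOrderSolution (r k) f x := by
  induction n with
  | zero => simp
  | succ n ih =>
    rw [iteratedDeriv_succ, ih fun j hj => hc j (by lia)]
    funext x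
    rw [(hasDerivAt_sum_smul_firstOrderSolution r (fun k => c k * r k ^ n) hf x).deriv,
      hc n n.lt_succ_self, zero_smul, add_zero]
    simp_rw [pow_succ, mul_assoc]

theorem Dop_sum_smul_firstOrderSolution {X ι : Type*} [NormedAddCommGroup X]
    [NormedSpace ℂ X] [CompleteSpace X] [Fintype ι] (n : ℕ) (a : Fin (n + 1) → ℂ)
    (r c : ι → ℂ)
    (hroot : ∀ k, r k ^ (n + 1) + ∑ j : Fin (n + 1), a j * r k ^ (n - (j : ℕ)) = 0)
    (hc : ∀ j < n, ∑ k, c k * r k ^ j = 0) (hcn : ∑ k, c k * r k ^ n = 1)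
    {f : ℝ → X} (hf : Continuous f) (x : ℝ) :
    Dop (n + 1) a (fun x => ∑ k, c k • firstOrderSolution (r k) f x) x = f x := by
  have hlow (j : Fin (n + 1)) :=
    iteratedDeriv_sum_smul_firstOrderSolution r c hf (n - j) fun i hi => hc i (by lia)
  rw [Dop, iteratedDeriv_succ, iteratedDeriv_sum_smul_firstOrderSolution r c hf n hc,
    (hasDerivAt_sum_smul_firstOrderSolution r (fun k => c k * r k ^ n) hf x).deriv, hcn, one_smul]
  simp_rw [Nat.add_sub_cancel, hlow, Finset.smul_sum, smul_smul]
  rw [Finset.sum_comm, add_right_comm, ← Finset.sum_add_distrib, add_eq_right]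
  refine Finset.sum_eq_zero fun k _ => ?_
  rw [← Finset.sum_smul, ← add_smul]
  have h : c k * r k ^ n * r k + ∑ j : Fin (n + 1), a j * (c k * r k ^ (n - (j : ℕ))) =
      c k * (r k ^ (n + 1) + ∑ j : Fin (n + 1), a j * r k ^ (n - (j : ℕ))) := by
    simp_rw [mul_add, Finset.mul_sum, mul_left_comm (a _), pow_succ, mul_assoc]
  rw [h, hroot, mul_zero, zero_smul]

/-- Cofactor expansion of the Vandermonde determinant along its last column, and of the matrices
obtained by replacing that column with another one. -/
theorem sum_VandDel_mul_pow {n : ℕ} (r : Fin (n + 1) → ℂ) (j : Fin (n + 1)) :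
    ∑ k : Fin (n + 1), (-1 : ℂ) ^ ((n + 1) + ((k : ℕ) + 1)) * VandDel r k * r k ^ (j : ℕ) =
      if Fin.last n = j then (Matrix.vandermonde r).det else 0 := by
  have h := congr_fun₂ (Matrix.adjugate_mul (Matrix.vandermonde r)) (Fin.last n) j
  rw [Matrix.mul_apply, Matrix.smul_apply, Matrix.one_apply, smul_eq_mul, mul_ite, mul_one,
    mul_zero] at h
  rw [← h]
  refine Finset.sum_congr rfl fun k _ => ?_
  rw [Matrix.adjugate_fin_succ_eq_det_submatrix, Matrix.vandermonde_apply, VandDel]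
  congr 2
  · rw [Fin.val_last]
    ring
  · congr 1
    ext i l
    simp [Matrix.vandermonde_apply]

theorem stmt16 {X : Type*} [NormedAddCommGroup X] [NormedSpace ℂ X] [CompleteSpace X]
    (n : ℕ) (a : Fin (n + 1) → ℂ) (r : Fin (n + 1) → ℂ)
    (hroot : ∀ k, r k ^ (n + 1) + ∑ j : Fin (n + 1), a j * r k ^ (n - (j : ℕ)) = 0)
    (hinj : Function.Injective r)
    (f : ℝ → X) (hf : Continuous f)
    (yP : ℝ → X)
    (hyP : yP = fun x : ℝ =>
      ((1 : ℂ) / (Matrix.vandermonde r).det) •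
        ∑ k : Fin (n + 1),
          ((-1 : ℂ) ^ ((n + 1) + ((k : ℕ) + 1)) * VandDel r k * Complex.exp (r k * x)) •
            ∫ t in (0 : ℝ)..x, Complex.exp (-(r k) * t) • f t) :
    (ContDiff ℝ (n + 1) yP ∧ ∀ t : ℝ, Dop (n + 1) a yP t = f t) ∧
      ∀ g : ℝ → X, Continuous g →
        ∃ y : ℝ → X, ContDiff ℝ (n + 1) y ∧ ∀ t : ℝ, Dop (n + 1) a y t = g t := by
  have hV : (Matrix.vandermonde r).det ≠ 0 := Matrix.det_vandermonde_ne_zero_iff.2 hinj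
  set c : Fin (n + 1) → ℂ := fun k =>
    1 / (Matrix.vandermonde r).det * ((-1 : ℂ) ^ ((n + 1) + ((k : ℕ) + 1)) * VandDel r k) with hc
  have hsum (j : Fin (n + 1)) : ∑ k, c k * r k ^ (j : ℕ) = if Fin.last n = j then 1 else 0 := by
    simp_rw [hc, mul_assoc (1 / (Matrix.vandermonde r).det)]
    rw [← Finset.mul_sum, sum_VandDel_mul_pow, mul_ite, mul_zero, one_div_mul_cancel hV]
  have hlow : ∀ j < n, ∑ k, c k * r k ^ j = 0 := fun j hj => by
    have h := hsum ⟨j, by lia⟩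
    rwa [if_neg (by simp [Fin.ext_iff]; lia)] at h
  have htop : ∑ k, c k * r k ^ n = 1 := by simpa using hsum (Fin.last n)
  have hsol (g : ℝ → X) (hg : Continuous g) :
      ContDiff ℝ (n + 1) (fun x => ∑ k, c k • firstOrderSolution (r k) g x) ∧
        ∀ t, Dop (n + 1) a (fun x => ∑ k, c k • firstOrderSolution (r k) g x) t = g t :=
    ⟨contDiff_sum_smul_firstOrderSolution r hg n c hlow,
      Dop_sum_smul_firstOrderSolution n a r c hroot hlow htop hg⟩
  have hy : yP = fun x => ∑ k, c k • firstOrderSolution (r k) f x := by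
    rw [hyP]
    funext x
    simp_rw [Finset.smul_sum, hc, firstOrderSolution, smul_smul, mul_assoc]
  exact ⟨hy ▸ hsol f hf, fun g hg => ⟨_, hsol g hg⟩⟩
end

section
/- Let D(y) = y″ + a₁y′ + a₂y with a₁, a₂ ∈ ℂ, and suppose the roots r₁, r₂ of z² + a₁z + a₂ = 0 satisfy Re r₁ > 0 and Re r₂ < 0. Then the best Ulam constant of D equals (1/|r₁ − r₂|)·| 1/Re r₁ − 1/Re r₂ |. -/
open MeasureTheory

section SecondOrder

variable {X : Type*} [NormedAddCommGroup X] [NormedSpace ℂ X]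

lemma hasDerivAt_cexp_mul (r : ℂ) (t : ℝ) :
    HasDerivAt (fun s : ℝ => Complex.exp (r * s)) (r * Complex.exp (r * t)) t := by
  have h := ((hasDerivAt_id (t : ℂ)).const_mul r).cexp.comp_ofReal
  simpa [mul_comm] using h

lemma norm_cexp_mul_ofReal (r : ℂ) (t : ℝ) :
    ‖Complex.exp (r * t)‖ = Real.exp (r.re * t) := by
  simp [Complex.norm_exp]

/-- The bounded solution of `g' = r g - f` for bounded continuous `f` and `0 < Re r`. -/
lemma exists_bounded_solution_first_order {r : ℂ} (hr : 0 < r.re) [CompleteSpace X]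
    {f : ℝ → X} (hf : Continuous f) {M : ℝ} (hM : ∀ t, ‖f t‖ ≤ M) :
    ∃ g : ℝ → X, (∀ t, HasDerivAt g (r • g t - f t) t) ∧ (∀ t, ‖g t‖ ≤ M / r.re) ∧
      g 0 = ∫ s in Set.Ioi (0 : ℝ), Complex.exp (-r * s) • f s := by
  set k : ℝ → X := fun s => Complex.exp (-r * s) • f s with hk
  have hkc : Continuous k := by rw [hk]; fun_prop
  have hbound : ∀ s, ‖k s‖ ≤ M * Real.exp (-r.re * s) := fun s => by
    simp only [hk, norm_smul, norm_cexp_mul_ofReal, Complex.neg_re]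
    rw [mul_comm]
    gcongr
    exact hM s
  have hdom : ∀ t : ℝ, IntegrableOn (fun s : ℝ => M * Real.exp (-r.re * s)) (Set.Ioi t) :=
    fun t => (exp_neg_integrableOn_Ioi t hr).const_mul M
  have hki : ∀ t : ℝ, IntegrableOn k (Set.Ioi t) := fun t =>
    (hdom t).mono' hkc.aestronglyMeasurable (Filter.Eventually.of_forall hbound)
  have htail : ∀ t : ℝ, (∫ s in Set.Ioi (0 : ℝ), k s) - ∫ s in (0 : ℝ)..t, k s =
      ∫ s in Set.Ioi t, k s := fun t => by
    rw [← intervalIntegral.integral_interval_add_Ioi (hki 0) (hki t)]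
    simp
  refine ⟨fun t => Complex.exp (r * t) •
    ((∫ s in Set.Ioi (0 : ℝ), k s) - ∫ s in (0 : ℝ)..t, k s), fun t => ?_, fun t => ?_, ?_⟩
  · have h1 : HasDerivAt (fun u : ℝ => (∫ s in Set.Ioi (0 : ℝ), k s) - ∫ s in (0 : ℝ)..u, k s)
        (-(k t)) t := by
      simpa using (hkc.integral_hasStrictDerivAt 0 t).hasDerivAt.const_sub
        (∫ s in Set.Ioi (0 : ℝ), k s)
    refine ((hasDerivAt_cexp_mul r t).fun_smul h1).congr_deriv ?_
    have h3 : Complex.exp (r * t) • k t = f t := by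
      simp [hk, smul_smul, ← Complex.exp_add]
    simp only [smul_neg, h3, mul_smul]
    abel
  · beta_reduce
    rw [htail, norm_smul, norm_cexp_mul_ofReal]
    calc Real.exp (r.re * t) * ‖∫ s in Set.Ioi t, k s‖
        ≤ Real.exp (r.re * t) * ∫ s in Set.Ioi t, M * Real.exp (-r.re * s) := by
          gcongr
          exact norm_integral_le_of_norm_le (hdom t) (Filter.Eventually.of_forall hbound)
      _ = M / r.re := by
          rw [integral_const_mul, integral_exp_mul_Ioi (by linarith)]
          have h : Real.exp (r.re * t) * Real.exp (-r.re * t) = 1 := by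
            simp [← Real.exp_add]
          calc Real.exp (r.re * t) * (M * (-Real.exp (-r.re * t) / -r.re))
              = M / r.re * (Real.exp (r.re * t) * Real.exp (-r.re * t)) := by
                rw [neg_div_neg_eq]
                ring
            _ = M / r.re := by rw [h, mul_one]
  · simp

lemma contDiff_two_of_hasDerivAt {w w' w'' : ℝ → X} (h : ∀ t, HasDerivAt w (w' t) t)
    (h' : ∀ t, HasDerivAt w' (w'' t) t) (hc : Continuous w'') : ContDiff ℝ 2 w := by
  have e : deriv w = w' := funext fun t => (h t).deriv
  have e' : deriv w' = w'' := funext fun t => (h' t).deriv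
  have h1 : ContDiff ℝ 1 w' :=
    contDiff_one_iff_deriv.2 ⟨fun t => (h' t).differentiableAt, e' ▸ hc⟩
  rw [show (2 : WithTop ℕ∞) = 1 + 1 by norm_num, contDiff_succ_iff_deriv]
  exact ⟨fun t => (h t).differentiableAt, by simp, e ▸ h1⟩

lemma Dop2_eq_of_hasDerivAt (a₁ a₂ : ℂ) {w w' w'' : ℝ → X} (h : ∀ t, HasDerivAt w (w' t) t)
    (h' : ∀ t, HasDerivAt w' (w'' t) t) (t : ℝ) :
    Dop2 a₁ a₂ w t = w'' t + a₁ • w' t + a₂ • w t := by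
  have e : deriv w = w' := funext fun t => (h t).deriv
  simp [Dop2, iteratedDeriv_succ, e, (h' t).deriv]

lemma ContDiff.hasDerivAt_of_two {y : ℝ → X} (hy : ContDiff ℝ 2 y) (t : ℝ) :
    HasDerivAt y (deriv y t) t :=
  (hy.differentiable (by norm_num) t).hasDerivAt

lemma ContDiff.hasDerivAt_deriv_of_two {y : ℝ → X} (hy : ContDiff ℝ 2 y) (t : ℝ) :
    HasDerivAt (deriv y) (iteratedDeriv 2 y t) t := by
  have h := hy.differentiable_iteratedDeriv 1 (by norm_num) t
  simpa [iteratedDeriv_succ] using h.hasDerivAt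

lemma continuous_Dop2 (a₁ a₂ : ℂ) {y : ℝ → X} (hy : ContDiff ℝ 2 y) :
    Continuous (Dop2 a₁ a₂ y) := by
  have h0 := hy.continuous
  have h1 := hy.continuous_deriv (by norm_num)
  have h2 := hy.continuous_iteratedDeriv 2 le_rfl
  unfold Dop2
  fun_prop

lemma Dop2_sub (a₁ a₂ : ℂ) {y w : ℝ → X} (hy : ContDiff ℝ 2 y) (hw : ContDiff ℝ 2 w) (t : ℝ) :
    Dop2 a₁ a₂ (fun s => y s - w s) t = Dop2 a₁ a₂ y t - Dop2 a₁ a₂ w t := by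
  rw [Dop2_eq_of_hasDerivAt a₁ a₂
    (fun s => (hy.hasDerivAt_of_two s).fun_sub (hw.hasDerivAt_of_two s))
    (fun s => (hy.hasDerivAt_deriv_of_two s).fun_sub (hw.hasDerivAt_deriv_of_two s))]
  simp only [Dop2, smul_sub]
  abel

/-- The bounded solution of `D(w) = f` for bounded continuous `f`, when the characteristic roots
lie on different sides of the imaginary axis. -/
lemma exists_bounded_solution_Dop2 [CompleteSpace X] {a₁ a₂ r₁ r₂ : ℂ}
    (hr₁ : r₁ ^ 2 + a₁ * r₁ + a₂ = 0) (hr₂ : r₂ ^ 2 + a₁ * r₂ + a₂ = 0)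
    (hre₁ : 0 < r₁.re) (hre₂ : r₂.re < 0) {f : ℝ → X} (hf : Continuous f) {M : ℝ}
    (hM : ∀ t, ‖f t‖ ≤ M) :
    ∃ w : ℝ → X, ContDiff ℝ 2 w ∧ (∀ t, Dop2 a₁ a₂ w t = f t) ∧
      (∀ t, ‖w t‖ ≤ (1 / ‖r₁ - r₂‖) * |1 / r₁.re - 1 / r₂.re| * M) ∧
      w 0 = -(1 / (r₁ - r₂)) • ((∫ s in Set.Ioi (0 : ℝ), Complex.exp (-r₁ * s) • f s) +
        ∫ s in Set.Ioi (0 : ℝ), Complex.exp (r₂ * s) • f (-s)) := by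
  have hne : r₁ - r₂ ≠ 0 := fun h => by
    have := congrArg Complex.re h
    simp at this
    linarith
  obtain ⟨g, hg, hgb, hg0⟩ := exists_bounded_solution_first_order hre₁ hf hM
  obtain ⟨k, hk, hkb, hk0⟩ := exists_bounded_solution_first_order
    (r := -r₂) (by simpa using hre₂) (hf.comp continuous_neg) (fun t => hM (-t))
  have hh : ∀ t, HasDerivAt (fun t => k (-t)) (r₂ • k (-t) + f t) t := fun t => by
    refine ((hk (-t)).scomp t (hasDerivAt_neg t)).congr_deriv ?_
    simp only [Function.comp_apply, neg_neg]
    module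
  have hgc : Continuous g := continuous_iff_continuousAt.2 fun t => (hg t).continuousAt
  have hkc : Continuous k := continuous_iff_continuousAt.2 fun t => (hk t).continuousAt
  have hw : ∀ t, HasDerivAt (fun t => -(1 / (r₁ - r₂)) • (g t + k (-t)))
      (-(1 / (r₁ - r₂)) • (r₁ • g t + r₂ • k (-t))) t := fun t => by
    have h := ((hg t).fun_add (hh t)).fun_const_smul (-(1 / (r₁ - r₂)))
    convert h using 2
    abel
  have hw' : ∀ t, HasDerivAt (fun t => -(1 / (r₁ - r₂)) • (r₁ • g t + r₂ • k (-t)))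
      (-(1 / (r₁ - r₂)) • (r₁ • (r₁ • g t - f t) + r₂ • (r₂ • k (-t) + f t))) t := fun t =>
    (((hg t).fun_const_smul r₁).fun_add ((hh t).fun_const_smul r₂)).fun_const_smul _
  refine ⟨fun t => -(1 / (r₁ - r₂)) • (g t + k (-t)),
    contDiff_two_of_hasDerivAt hw hw' (by fun_prop), fun t => ?_, fun t => ?_, ?_⟩
  · rw [Dop2_eq_of_hasDerivAt a₁ a₂ hw hw']
    match_scalars
    · field_simp
      linear_combination -hr₁
    · field_simp
      ring
    · field_simp
      linear_combination -hr₂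
  · have hpos : 0 ≤ 1 / r₁.re - 1 / r₂.re := by
      have h1 : 0 < 1 / r₁.re := by positivity
      have h2 : 1 / r₂.re < 0 := one_div_neg.2 hre₂
      linarith
    rw [norm_smul, norm_neg, norm_div, norm_one, abs_of_nonneg hpos, mul_assoc]
    gcongr
    calc ‖g t + k (-t)‖ ≤ M / r₁.re + M / (-r₂).re := norm_add_le_of_le (hgb t) (hkb (-t))
      _ = (1 / r₁.re - 1 / r₂.re) * M := by
        rw [Complex.neg_re, div_neg]
        ring
  · simp [hg0, hk0]

lemma eq_cexp_smul_of_hasDerivAt {r : ℂ} {p : ℝ → X} (hp : ∀ t, HasDerivAt p (r • p t) t) (t : ℝ) :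
    p t = Complex.exp (r * t) • p 0 := by
  have hd : ∀ s, HasDerivAt (fun s : ℝ => Complex.exp (-r * s) • p s) 0 s := fun s => by
    refine ((hasDerivAt_cexp_mul (-r) s).fun_smul (hp s)).congr_deriv ?_
    module
  have hc : Complex.exp (-r * t) • p t = p 0 := by
    simpa using is_const_of_deriv_eq_zero (fun s => (hd s).differentiableAt)
      (fun s => (hd s).deriv) t 0
  rw [← hc, smul_smul, ← Complex.exp_add]
  simp

lemma eq_zero_of_exp_mul_norm_le {E : Type*} [NormedAddCommGroup E] {a C : ℝ} (ha : 0 < a) {x : E}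
    (h : ∀ t : ℝ, 0 ≤ t → Real.exp (a * t) * ‖x‖ ≤ C) : x = 0 := by
  by_contra hx
  have hx' : 0 < ‖x‖ := norm_pos_iff.2 hx
  have hC : 0 ≤ C := le_trans (by positivity) (h 0 le_rfl)
  have h1 := h (C / (a * ‖x‖)) (by positivity)
  have h2 : C / ‖x‖ + 1 ≤ Real.exp (a * (C / (a * ‖x‖))) := by
    convert Real.add_one_le_exp (a * (C / (a * ‖x‖))) using 2
    field_simp
  have h3 : (C / ‖x‖ + 1) * ‖x‖ ≤ C := le_trans (by gcongr) h1
  rw [add_mul, div_mul_cancel₀ _ hx'.ne'] at h3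
  linarith

lemma eq_zero_of_bounded_of_Dop2_eq_zero {a₁ a₂ r₁ r₂ : ℂ}
    (hr₁ : r₁ ^ 2 + a₁ * r₁ + a₂ = 0) (hr₂ : r₂ ^ 2 + a₁ * r₂ + a₂ = 0)
    (hre₁ : 0 < r₁.re) (hre₂ : r₂.re < 0) {z : ℝ → X} (hz : ContDiff ℝ 2 z)
    (hD : Dop2 a₁ a₂ z = 0) {C : ℝ} (hC : ∀ t, ‖z t‖ ≤ C) (t : ℝ) : z t = 0 := by
  have hne : r₁ - r₂ ≠ 0 := fun h => by
    have := congrArg Complex.re h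
    simp at this
    linarith
  have ha₁ : a₁ = -(r₁ + r₂) := by
    apply mul_left_cancel₀ hne
    linear_combination hr₁ - hr₂
  have ha₂ : a₂ = r₁ * r₂ := by
    rw [ha₁] at hr₁
    linear_combination hr₁
  have hz2 : ∀ s, iteratedDeriv 2 z s = (r₁ + r₂) • deriv z s - (r₁ * r₂) • z s := fun s => by
    have h := congrFun hD s
    simp only [Dop2, Pi.zero_apply, ha₁, ha₂, neg_smul] at h
    rw [← sub_eq_zero, ← h]
    abel
  have hfactor : ∀ r r' : ℂ, r + r' = r₁ + r₂ → r * r' = r₁ * r₂ → ∀ s : ℝ,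
      deriv z s - r' • z s = Complex.exp (r * s) • (deriv z 0 - r' • z 0) := fun r r' h1 h2 s =>
    eq_cexp_smul_of_hasDerivAt (p := fun s => deriv z s - r' • z s) (fun s => by
      convert (hz.hasDerivAt_deriv_of_two s).fun_sub
        ((hz.hasDerivAt_of_two s).fun_const_smul r') using 1
      rw [hz2, ← h1, ← h2]
      module) s
  set p := deriv z 0 - r₂ • z 0
  set q := deriv z 0 - r₁ • z 0
  have hp := hfactor r₁ r₂ rfl rfl
  have hq := hfactor r₂ r₁ (add_comm _ _) (mul_comm _ _)
  have hsol : ∀ s : ℝ, (r₁ - r₂) • z s =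
      Complex.exp (r₁ * s) • p - Complex.exp (r₂ * s) • q := fun s => by
    rw [← hp, ← hq]
    module
  have hnorm : ∀ s, ‖(r₁ - r₂) • z s‖ ≤ ‖r₁ - r₂‖ * C := fun s => by
    rw [norm_smul]
    gcongr
    exact hC s
  have hp0 : p = 0 := eq_zero_of_exp_mul_norm_le (C := ‖r₁ - r₂‖ * C + ‖q‖) hre₁ fun s hs => by
    have h1 : Complex.exp (r₁ * s) • p = (r₁ - r₂) • z s + Complex.exp (r₂ * s) • q := by
      rw [hsol]; abel
    rw [← norm_cexp_mul_ofReal, ← norm_smul, h1]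
    refine norm_add_le_of_le (hnorm s) ?_
    rw [norm_smul, norm_cexp_mul_ofReal]
    exact mul_le_of_le_one_left (norm_nonneg _)
      (Real.exp_le_one_iff.2 (mul_nonpos_of_nonpos_of_nonneg hre₂.le hs))
  have hq0 : q = 0 := eq_zero_of_exp_mul_norm_le (C := ‖r₁ - r₂‖ * C) (neg_pos.2 hre₂)
    fun s hs => by
      have h := hnorm (-s)
      rw [hsol, hp0, smul_zero, zero_sub, norm_neg, norm_smul, norm_cexp_mul_ofReal] at h
      simpa using h
  have h := hsol t
  rw [hp0, hq0, smul_zero, smul_zero, sub_zero] at h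
  exact (smul_eq_zero.1 h).resolve_left hne

/-- A unimodular function which cancels the phase of both exponentials in the Green function. -/
lemma exists_extremal_phase (β₁ β₂ : ℝ) :
    ∃ φ : ℝ → ℂ, Continuous φ ∧ (∀ t, ‖φ t‖ = 1) ∧
      (∀ t : ℝ, 0 < t → φ t = Complex.exp (β₁ * t * Complex.I)) ∧
      ∀ t : ℝ, 0 < t → φ (-t) = Complex.exp (-(β₂ * t * Complex.I)) := by
  refine ⟨fun t => Complex.exp ((β₁ * max t 0 + β₂ * min t 0 : ℝ) * Complex.I), by fun_prop,
    fun t => Complex.norm_exp_ofReal_mul_I _, fun t ht => ?_, fun t ht => ?_⟩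
  · simp [ht.le]
  · simp [ht.le]

end SecondOrder

theorem stmt18 {X : Type*} [NormedAddCommGroup X] [NormedSpace ℂ X] [CompleteSpace X]
    [Nontrivial X]
    (a₁ a₂ : ℂ) (r₁ r₂ : ℂ)
    (hr₁ : r₁ ^ 2 + a₁ * r₁ + a₂ = 0) (hr₂ : r₂ ^ 2 + a₁ * r₂ + a₂ = 0)
    (hre₁ : 0 < r₁.re) (hre₂ : r₂.re < 0) :
    IsUlamConstant2 (X := X) a₁ a₂ ((1 / ‖r₁ - r₂‖) * |1 / r₁.re - 1 / r₂.re|) ∧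
      ∀ K : ℝ, IsUlamConstant2 (X := X) a₁ a₂ K →
        (1 / ‖r₁ - r₂‖) * |1 / r₁.re - 1 / r₂.re| ≤ K := by
  refine ⟨⟨by positivity, fun ε _ y hy hD => ?_⟩, fun K hK => ?_⟩
  · obtain ⟨w, hw, hDw, hwb, -⟩ := exists_bounded_solution_Dop2 hr₁ hr₂ hre₁ hre₂
      (continuous_Dop2 a₁ a₂ hy) hD
    refine ⟨fun t => y t - w t, hy.sub hw, funext fun t => ?_, fun t => ?_⟩
    · rw [Dop2_sub a₁ a₂ hy hw, hDw, sub_self, Pi.zero_apply]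
    · simpa using hwb t
  · obtain ⟨x, hx⟩ := exists_ne (0 : X)
    obtain ⟨u, hu⟩ : ∃ u : X, ‖u‖ = 1 :=
      ⟨((‖x‖⁻¹ : ℝ) : ℂ) • x, by simp [norm_smul, hx]⟩
    obtain ⟨φ, hφ, hφ1, hφpos, hφneg⟩ := exists_extremal_phase r₁.im r₂.im
    have hM : ∀ t, ‖φ t • u‖ ≤ 1 := fun t => by simp [norm_smul, hφ1, hu]
    obtain ⟨w, hw, hDw, hwb, hw0⟩ := exists_bounded_solution_Dop2 hr₁ hr₂ hre₁ hre₂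
      (f := fun t => φ t • u) (by fun_prop) hM
    obtain ⟨z, hz, hDz, hwz⟩ := hK.2 1 one_pos w hw fun t => by rw [hDw]; exact hM t
    have hz0 : z 0 = 0 := eq_zero_of_bounded_of_Dop2_eq_zero hr₁ hr₂ hre₁ hre₂ hz hDz
      (fun t => by
        have h := norm_sub_le (w t) (w t - z t)
        rw [sub_sub_cancel] at h
        exact h.trans (add_le_add (hwb t) (hwz t))) 0
    have hI₁ : ∫ s in Set.Ioi (0 : ℝ), Complex.exp (-r₁ * s) • φ s • u =
        ((1 / r₁.re : ℝ) : ℂ) • u := by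
      have h : ∀ s ∈ Set.Ioi (0 : ℝ), Complex.exp (-r₁ * s) • φ s • u =
          ((Real.exp (-r₁.re * s) : ℝ) : ℂ) • u := fun s hs => by
        rw [hφpos s hs, smul_smul, ← Complex.exp_add]
        congr 1
        push_cast
        congr 1
        linear_combination s * Complex.re_add_im r₁
      rw [setIntegral_congr_fun measurableSet_Ioi h, integral_smul_const, integral_complex_ofReal,
        integral_exp_mul_Ioi (by linarith)]
      simp
    have hI₂ : ∫ s in Set.Ioi (0 : ℝ), Complex.exp (r₂ * s) • φ (-s) • u =
        ((-(1 / r₂.re) : ℝ) : ℂ) • u := by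
      have h : ∀ s ∈ Set.Ioi (0 : ℝ), Complex.exp (r₂ * s) • φ (-s) • u =
          ((Real.exp (r₂.re * s) : ℝ) : ℂ) • u := fun s hs => by
        rw [hφneg s hs, smul_smul, ← Complex.exp_add]
        congr 1
        push_cast
        congr 1
        linear_combination -s * Complex.re_add_im r₂
      rw [setIntegral_congr_fun measurableSet_Ioi h, integral_smul_const, integral_complex_ofReal,
        integral_exp_mul_Ioi hre₂]
      simp [neg_div]
    have hK0 := hwz 0
    rw [hz0, sub_zero, hw0, hI₁, hI₂, ← add_smul, ← Complex.ofReal_add, norm_smul, norm_smul, hu,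
      norm_neg, norm_div, norm_one, Complex.norm_real, Real.norm_eq_abs, ← sub_eq_add_neg] at hK0
    simpa using hK0
end
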